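/- arXiv:1810.07107 — 2 statements merged into one kernel-verified Lean document; each statement's English description precedes it below -/
import Mathlib

section
/- Let f be an orientation-preserving diffeomorphism of the circle T = R/Z with irrational rotation number such that log Df has bounded variation (for example, f of class C²). Then there exists a homeomorphism h: T → T such that h∘f = T_{ρ(f)}∘h; i.e., f is topologically conjugate to the rotation by its rotation number. -/
open Filter Topology

/-- `ρ` is the rotation (translation) number of the lift `F`. -/
def IsRotNumber (F : ℝ → ℝ) (ρ : ℝ) : Prop :=
  ∀ x : ℝ, Tendsto (fun n : ℕ => (F^[n] x - x) / (n : ℝ)) atTop (𝓝 ρ)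

/-- A lift of an orientation-preserving `C¹` diffeomorphism of the circle `ℝ/ℤ`. -/
structure C1CircleDiffeoLift where
  toFun : ℝ → ℝ
  contDiff : ContDiff ℝ 1 toFun
  deriv_pos : ∀ x, 0 < deriv toFun x
  map_add_one : ∀ x, toFun (x + 1) = toFun x + 1

open Set MeasureTheory

/-- The increments of a monotone function along separated intervals add up to at most its total
increment. -/
lemma MonotoneOn.sum_sub_le_of_separated {ι : Type*} {v : ℝ → ℝ} {a b : ℝ}
    (hv : MonotoneOn v (Icc a b)) (hab : a ≤ b) (s : Finset ι) (l r : ι → ℝ)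
    (hl : ∀ i ∈ s, l i ∈ Icc a b) (hr : ∀ i ∈ s, r i ∈ Icc a b) (hlr : ∀ i ∈ s, l i ≤ r i)
    (hsep : ∀ i ∈ s, ∀ j ∈ s, i ≠ j → r i < l j ∨ r j < l i) :
    ∑ i ∈ s, (v (r i) - v (l i)) ≤ v b - v a := by
  have ha : a ∈ Icc a b := left_mem_Icc.2 hab
  have hb : b ∈ Icc a b := right_mem_Icc.2 hab
  have hdisj : (s : Set ι).PairwiseDisjoint fun i => Ioo (v (l i)) (v (r i)) := by
    intro i hi j hj hij
    refine Set.disjoint_left.2 fun x hxi hxj => ?_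
    rcases hsep i hi j hj hij with h | h
    · exact absurd (hv (hr i hi) (hl j hj) h.le) (not_le.2 (hxj.1.trans hxi.2))
    · exact absurd (hv (hr j hj) (hl i hi) h.le) (not_le.2 (hxi.1.trans hxj.2))
  have hsub : (⋃ i ∈ s, Ioo (v (l i)) (v (r i))) ⊆ Ioo (v a) (v b) :=
    iUnion₂_subset fun i hi => Ioo_subset_Ioo (hv ha (hl i hi) (hl i hi).1)
      (hv (hr i hi) hb (hr i hi).2)
  have hle := measure_mono (μ := volume) hsub
  rw [measure_biUnion_finset hdisj fun _ _ => measurableSet_Ioo] at hle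
  simp only [Real.volume_Ioo] at hle
  rw [← ENNReal.ofReal_sum_of_nonneg fun i hi =>
    sub_nonneg.2 (hv (hl i hi) (hr i hi) (hlr i hi))] at hle
  exact (ENNReal.ofReal_le_ofReal_iff (sub_nonneg.2 (hv ha hb hab))).1 hle

/-- Let `φ` have `1`-periodic increments and bounded variation on `[0, 2]`. Then the increments of
`φ` along intervals of length less than one which are separated modulo `1` add up to at most the
variation of `φ` on `[0, 2]`. -/
lemma sum_abs_sub_le_of_separated_mod_one {ι : Type*} {φ : ℝ → ℝ}
    (hper : ∀ x y, φ (y + 1) - φ (x + 1) = φ y - φ x) (hφ : BoundedVariationOn φ (Icc 0 2))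
    (s : Finset ι) (l r : ι → ℝ) (hlr : ∀ i ∈ s, l i ≤ r i) (hlr' : ∀ i ∈ s, r i < l i + 1)
    (hsep : ∀ i ∈ s, ∀ j ∈ s, i ≠ j → ∀ m : ℤ, r i < l j + m ∨ r j + m < l i) :
    ∑ i ∈ s, |φ (r i) - φ (l i)| ≤ (eVariationOn φ (Icc 0 2)).toReal := by
  have hloc := hφ.locallyBoundedVariationOn
  have h0 : (0 : ℝ) ∈ Icc (0 : ℝ) 2 := by simp
  have h2 : (0 : ℝ) ≤ 2 := by norm_num
  have hshift : ∀ (x y : ℝ) (n : ℤ), φ (y - n) - φ (x - n) = φ y - φ x := by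
    intro x y n
    have hp : Function.Periodic (fun z => φ (y + z) - φ (x + z)) 1 := fun z => by
      simp only [← add_assoc]; exact hper _ _
    simpa [sub_eq_add_neg] using hp.int_mul (-n) 0
  set v := variationOnFromTo φ (Icc 0 2) 0 with hvdef
  have hl : ∀ i ∈ s, l i - ⌊l i⌋ ∈ Icc (0 : ℝ) 2 := fun i _ =>
    ⟨by linarith [Int.floor_le (l i)], by linarith [Int.lt_floor_add_one (l i)]⟩
  have hr : ∀ i ∈ s, r i - ⌊l i⌋ ∈ Icc (0 : ℝ) 2 := fun i hi =>
    ⟨by linarith [Int.floor_le (l i), hlr i hi],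
      by linarith [Int.lt_floor_add_one (l i), hlr' i hi]⟩
  have hsum := (variationOnFromTo.monotoneOn hloc h0).sum_sub_le_of_separated h2 s
    (fun i => l i - ⌊l i⌋) (fun i => r i - ⌊l i⌋) hl hr
    (fun i hi => sub_le_sub_right (hlr i hi) _) (by
      intro i hi j hj hij
      rcases hsep i hi j hj hij (⌊l i⌋ - ⌊l j⌋) with h | h
      · left; push_cast at h; linarith
      · right; push_cast at h; linarith)
  have htot : v 2 - v 0 = (eVariationOn φ (Icc 0 2)).toReal := by
    rw [hvdef, variationOnFromTo.self, variationOnFromTo.eq_of_le _ _ h2, inter_self, sub_zero]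
  rw [← htot]
  refine le_trans (Finset.sum_le_sum fun i hi => ?_) hsum
  rw [← hshift (l i) (r i) ⌊l i⌋]
  exact variationOnFromTo.abs_sub_le_sub_of_le hloc h0 (hl i hi) (hr i hi)
    (sub_le_sub_right (hlr i hi) _)

/-- The increments of `φ` along intervals which a degree one lift `F` maps to
`[A + i σ, A + δ + i σ]`, `i < q`, have bounded sum as soon as these images are disjoint
modulo `1`. -/
lemma CircleDeg1Lift.sum_abs_sub_le (F : CircleDeg1Lift) {φ : ℝ → ℝ}
    (hper : ∀ x y, φ (y + 1) - φ (x + 1) = φ y - φ x) (hφ : BoundedVariationOn φ (Icc 0 2))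
    {A σ δ : ℝ} (hδ : δ < 1) (q : ℕ) (l r : ℕ → ℝ) (hlr : ∀ i, l i ≤ r i)
    (hl : ∀ i, F (l i) = A + i * σ) (hr : ∀ i, F (r i) = A + δ + i * σ)
    (hgap : ∀ k : ℤ, k ≠ 0 → |k| < q → ∀ m : ℤ, δ < |k * σ - m|) :
    ∑ i ∈ Finset.range q, |φ (r i) - φ (l i)| ≤ (eVariationOn φ (Icc 0 2)).toReal := by
  refine sum_abs_sub_le_of_separated_mod_one hper hφ _ l r (fun i _ => hlr i) (fun i _ => ?_) ?_
  · by_contra! h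
    have := F.monotone h
    rw [F.map_add_one, hl, hr] at this
    linarith
  · intro i hi j hj hij m
    by_contra! h
    have h₁ := F.monotone h.1
    have h₂ := F.monotone h.2
    rw [F.map_add_int, hl, hr] at h₁ h₂
    rw [Finset.mem_range] at hi hj
    refine (hgap ((i : ℤ) - j) (by omega) (by rw [abs_lt]; omega) m).not_ge ?_
    push_cast
    rw [abs_le]
    constructor <;> linarith

/-- Arbitrarily late best approximations of an irrational number by rationals. -/
lemma Irrational.exists_best_approximation {ρ : ℝ} (hρ : Irrational ρ) (N : ℕ) :
    ∃ q : ℕ, N < q ∧ ∃ p : ℤ, |q * ρ - p| < 1 ∧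
      ∀ k : ℤ, k ≠ 0 → |k| < q → ∀ m : ℤ, |q * ρ - p| < |k * ρ - m| := by
  let d : ℕ → ℝ := fun k => |k * ρ - round (k * ρ)|
  have hd : ∀ k : ℕ, 0 < k → 0 < d k := fun k hk =>
    abs_pos.2 (sub_ne_zero.2 ((hρ.natCast_mul hk.ne').ne_int _))
  obtain ⟨ε, hε, hεd⟩ : ∃ ε > 0, ∀ k : ℕ, 0 < k → k ≤ N → ε ≤ d k := by
    clear_value d
    induction N with
    | zero => exact ⟨1, one_pos, fun k h₁ h₂ => by omega⟩
    | succ n ih =>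
      obtain ⟨ε, hε, h⟩ := ih
      refine ⟨min ε (d (n + 1)), lt_min hε (hd _ n.succ_pos), fun k h₁ h₂ => ?_⟩
      rcases h₂.lt_or_eq with h₃ | rfl
      · exact (min_le_left _ _).trans (h k h₁ (by omega))
      · exact min_le_right _ _
  have hex : ∃ q : ℕ, 0 < q ∧ d q < ε := by
    obtain ⟨n, hn⟩ := exists_nat_one_div_lt hε
    obtain ⟨k, hk, -, hk'⟩ := Real.exists_nat_abs_mul_sub_round_le ρ n.succ_pos
    refine ⟨k, hk, hk'.trans_lt (lt_of_le_of_lt ?_ hn)⟩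
    push_cast
    gcongr
    linarith
  classical
  obtain ⟨hq, hqε⟩ := Nat.find_spec hex
  refine ⟨Nat.find hex, ?_, round (Nat.find hex * ρ), ?_, fun k hk hkq m => ?_⟩
  · by_contra! h
    exact (hεd _ hq h).not_gt hqε
  · exact (abs_sub_round _).trans_lt (by norm_num)
  · have hk' : k.natAbs < Nat.find hex := by
      rw [Int.abs_eq_natAbs] at hkq
      exact_mod_cast hkq
    have hmin := Nat.find_min hex hk'
    have hge : ε ≤ d k.natAbs := by
      by_contra! h
      exact hmin ⟨Int.natAbs_pos.2 hk, h⟩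
    refine hqε.trans_le (hge.trans ?_)
    rcases Int.natAbs_eq k with h | h
    · have hc : (k : ℝ) = k.natAbs := by conv_lhs => rw [h, Int.cast_natCast]
      rw [hc]
      exact round_le _ m
    · have hc : (k : ℝ) = -k.natAbs := by
        conv_lhs => rw [h, Int.cast_neg, Int.cast_natCast]
      rw [hc, ← abs_neg (-(k.natAbs : ℝ) * ρ - m)]
      have hm := round_le ((k.natAbs : ℝ) * ρ) (-m)
      rw [Int.cast_neg] at hm
      exact hm.trans_eq (congrArg _ (by ring))

/-- Intervals which a degree one lift collapses to the points of an orbit of an irrational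
rotation have lengths tending to zero. -/
lemma CircleDeg1Lift.tendsto_length_zero (F : CircleDeg1Lift) {A σ : ℝ} (hσ : Irrational σ)
    (l r : ℕ → ℝ) (hlr : ∀ i, l i ≤ r i) (hl : ∀ i, F (l i) = A + i * σ)
    (hr : ∀ i, F (r i) = A + i * σ) : Tendsto (fun n => r n - l n) atTop (𝓝 0) := by
  have hbv : BoundedVariationOn (id : ℝ → ℝ) (Icc 0 2) := by
    have h := (monotone_id.monotoneOn (Icc (0 : ℝ) 2)).locallyBoundedVariationOn 0 2
      (by simp) (by simp)
    rwa [inter_self] at h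
  refine (summable_of_sum_range_le (c := (eVariationOn (id : ℝ → ℝ) (Icc 0 2)).toReal)
    (fun n => sub_nonneg.2 (hlr n)) fun n => ?_).tendsto_atTop_zero
  have h := F.sum_abs_sub_le (φ := id) (fun x y => by simp) hbv (δ := 0) one_pos n l r hlr hl
    (by simpa using hr) fun k hk _ m =>
      abs_pos.2 (sub_ne_zero.2 ((hσ.intCast_mul hk).ne_int m))
  exact (Finset.sum_le_sum fun i _ => le_abs_self _).trans h

/-- A degree one lift semiconjugating a surjective map to an irrational rotation is continuous. -/
lemma CircleDeg1Lift.continuous_of_semiconj (F : CircleDeg1Lift) {f : ℝ → ℝ} {ρ : ℝ}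
    (hρ : Irrational ρ) (hf : Function.Surjective f) (hF : ∀ x, F (f x) = F x + ρ) :
    Continuous F := by
  refine F.monotone.continuous_of_denseRange ?_
  have hdense : Dense (AddSubgroup.closure {ρ, 1} : Set ℝ) :=
    dense_addSubgroupClosure_pair_iff.2 (by simpa using hρ)
  have hrange : ∀ g ∈ AddSubgroup.closure ({ρ, 1} : Set ℝ),
      (∀ x, ∃ y, F y = F x + g) ∧ ∀ x, ∃ y, F y = F x + -g := by
    intro g hg
    induction hg using AddSubgroup.closure_induction with
    | mem g hg =>
      rcases hg with rfl | rfl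
      · refine ⟨fun x => ⟨f x, hF x⟩, fun x => ?_⟩
        obtain ⟨y, rfl⟩ := hf x
        exact ⟨y, by simp [hF]⟩
      · exact ⟨fun x => ⟨x + 1, F.map_add_one x⟩,
          fun x => ⟨x - 1, by simpa [sub_eq_add_neg] using F.map_sub_int x 1⟩⟩
    | zero => exact ⟨fun x => ⟨x, by simp⟩, fun x => ⟨x, by simp⟩⟩
    | add g h _ _ ihg ihh =>
      constructor
      · intro x
        obtain ⟨y, hy⟩ := ihg.1 x
        obtain ⟨z, hz⟩ := ihh.1 y
        exact ⟨z, by rw [hz, hy, add_assoc]⟩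
      · intro x
        obtain ⟨y, hy⟩ := ihg.2 x
        obtain ⟨z, hz⟩ := ihh.2 y
        exact ⟨z, by rw [hz, hy]; ring⟩
    | neg g _ ih => exact ⟨ih.2, by simpa using ih.1⟩
  refine ((Homeomorph.addLeft (F 0)).surjective.denseRange.dense_image
    (Homeomorph.addLeft (F 0)).continuous hdense).mono ?_
  rintro _ ⟨g, hg, rfl⟩
  exact (hrange g hg).1 0

/-- The derivative of an iterate, written through the Birkhoff sum of the logarithm of the
derivative. -/
lemma hasDerivAt_iterate_exp_sum_log {f : ℝ → ℝ} (hf : Differentiable ℝ f)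
    (hpos : ∀ x, 0 < deriv f x) (n : ℕ) (x : ℝ) :
    HasDerivAt f^[n] (Real.exp (∑ i ∈ Finset.range n, Real.log (deriv f (f^[i] x)))) x := by
  induction n with
  | zero => simpa using hasDerivAt_id x
  | succ n ih =>
    rw [Function.iterate_succ', Finset.sum_range_succ, Real.exp_add, Real.exp_log (hpos _), mul_comm]
    exact (hf _).hasDerivAt.comp x ih

/-- A `1`-periodic function of bounded variation on a period has bounded variation on two. -/
lemma Function.Periodic.boundedVariationOn_Icc_zero_two {φ : ℝ → ℝ} (hper : φ.Periodic 1)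
    (hφ : BoundedVariationOn φ (Icc 0 1)) : BoundedVariationOn φ (Icc 0 2) := by
  have hshift : eVariationOn φ (Icc 1 2) = eVariationOn φ (Icc 0 1) := by
    have h := eVariationOn.comp_eq_of_monotoneOn φ (t := Icc 0 1) (fun x : ℝ => x + 1)
      fun x _ y _ hxy => add_le_add_left hxy 1
    rw [show φ ∘ (fun x : ℝ => x + 1) = φ from funext hper, image_add_const_Icc] at h
    norm_num at h
    exact h.symm
  have hadd := eVariationOn.Icc_add_Icc φ (s := univ) (a := 0) (b := 1) (c := 2)
    zero_le_one one_le_two (mem_univ _)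
  simp only [univ_inter] at hadd
  rw [BoundedVariationOn, ← hadd, hshift]
  exact ENNReal.add_ne_top.2 ⟨hφ, hφ⟩

lemma CircleDeg1Lift.iterate_of_semiconj (F : CircleDeg1Lift) {f : ℝ → ℝ} {ρ : ℝ}
    (hF : ∀ x, F (f x) = F x + ρ) (n : ℕ) (x : ℝ) : F (f^[n] x) = F x + n * ρ := by
  induction n with
  | zero => simp
  | succ n ih =>
    rw [Function.iterate_succ_apply', hF, ih]
    push_cast
    ring

/-- **Denjoy's distortion estimate**: if `q` is the denominator of a best approximation of `ρ`,
the Birkhoff sums of length `q` along orbits over `c` and `c - q ρ` differ by a bounded amount. -/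
lemma CircleDeg1Lift.abs_sum_sub_sum_le (F : CircleDeg1Lift) {f φ : ℝ → ℝ} {ρ : ℝ}
    (hF : ∀ x, F (f x) = F x + ρ) (hper : φ.Periodic 1)
    (hφ : BoundedVariationOn φ (Icc 0 2)) {q : ℕ} {p : ℤ} (hne : q * ρ - p ≠ 0)
    (hqp : |q * ρ - p| < 1)
    (hgap : ∀ k : ℤ, k ≠ 0 → |k| < q → ∀ m : ℤ, |q * ρ - p| < |k * ρ - m|)
    {ξ η : ℝ} (hξη : F ξ = F η + q * ρ) :
    |∑ i ∈ Finset.range q, φ (f^[i] ξ) - ∑ i ∈ Finset.range q, φ (f^[i] η)| ≤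
      (eVariationOn φ (Icc 0 2)).toReal := by
  have hper' : ∀ x y, φ (y + 1) - φ (x + 1) = φ y - φ x := fun x y => by rw [hper, hper]
  have hshift : ∀ x, φ (x + p) = φ x := fun x => by simpa using hper.int_mul p x
  have hs : ∀ i : ℕ, F (f^[i] ξ) = F ξ + i * ρ := fun i => F.iterate_of_semiconj hF i ξ
  have ht : ∀ i : ℕ, F (f^[i] η + p) = F ξ - (q * ρ - p) + i * ρ := fun i => by
    rw [F.map_add_int, F.iterate_of_semiconj hF i η, hξη]
    ring
  rw [← Finset.sum_sub_distrib]
  refine (Finset.abs_sum_le_sum_abs _ _).trans ?_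
  rcases hne.lt_or_gt with h | h
  · rw [abs_of_neg h] at hqp hgap
    have hsum := F.sum_abs_sub_le hper' hφ hqp q (fun i => f^[i] ξ) (fun i => f^[i] η + p)
      (fun i => (F.monotone.reflect_lt (by rw [hs, ht]; linarith)).le) hs
      (fun i => by rw [ht]; ring) hgap
    simpa only [hshift, abs_sub_comm] using hsum
  · rw [abs_of_pos h] at hqp hgap
    have hsum := F.sum_abs_sub_le hper' hφ hqp q (fun i => f^[i] η + p) (fun i => f^[i] ξ)
      (fun i => (F.monotone.reflect_lt (by rw [hs, ht]; linarith)).le) ht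
      (fun i => by rw [hs]; ring) hgap
    simpa only [hshift] using hsum

/-- A semiconjugacy from a circle diffeomorphism whose derivative has logarithm of bounded variation
to an irrational rotation is injective. -/
lemma CircleDeg1Lift.strictMono_of_semiconj (F : CircleDeg1Lift) {f : ℝ → ℝ} {ρ : ℝ}
    (hρ : Irrational ρ) (hf : Differentiable ℝ f) (hpos : ∀ x, 0 < deriv f x)
    (hsurj : Function.Surjective f) (hF : ∀ x, F (f x) = F x + ρ)
    (hper : Function.Periodic (fun x => Real.log (deriv f x)) 1)
    (hφ : BoundedVariationOn (fun x => Real.log (deriv f x)) (Icc 0 2)) :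
    StrictMono F := by
  have hmono : StrictMono f := strictMono_of_deriv_pos hpos
  let g := Function.surjInv hsurj
  have hfg : Function.RightInverse g f := Function.surjInv_eq hsurj
  have hg : StrictMono g := fun x y hxy => hmono.lt_iff_lt.1 (by rwa [hfg, hfg])
  have hG : ∀ x, F (g x) = F x + -ρ := fun x => by
    have := hF (g x)
    rw [hfg] at this
    linarith
  refine F.monotone.strictMono_of_injective ?_
  by_contra hinj
  obtain ⟨a, b, hFab, hab⟩ : ∃ a b, F a = F b ∧ a < b := by
    simp only [Function.Injective, not_forall] at hinj
    obtain ⟨x, y, hxy, hne⟩ := hinj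
    rcases lt_or_gt_of_ne hne with h | h
    exacts [⟨x, y, hxy, h⟩, ⟨y, x, hxy.symm, h⟩]
  have hfwd := F.tendsto_length_zero hρ (fun n => f^[n] a) (fun n => f^[n] b)
    (fun n => (hmono.iterate n hab).le) (fun n => F.iterate_of_semiconj hF n a)
    fun n => by rw [hFab]; exact F.iterate_of_semiconj hF n b
  have hbwd := F.tendsto_length_zero hρ.neg (fun n => g^[n] a) (fun n => g^[n] b)
    (fun n => (hg.iterate n hab).le) (fun n => F.iterate_of_semiconj hG n a)
    fun n => by rw [hFab]; exact F.iterate_of_semiconj hG n b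
  set C := (eVariationOn (fun x => Real.log (deriv f x)) (Icc 0 2)).toReal with hC
  have hsmall : ∀ᶠ n in atTop,
      (f^[n] b - f^[n] a) * (g^[n] b - g^[n] a) < Real.exp (-C) * (b - a) ^ 2 := by
    refine (hfwd.mul hbwd).eventually_lt_const ?_
    rw [mul_zero]
    exact mul_pos (Real.exp_pos _) (pow_pos (sub_pos.2 hab) 2)
  obtain ⟨N, hN⟩ := eventually_atTop.1 hsmall
  obtain ⟨q, hNq, p, hqp, hgap⟩ := hρ.exists_best_approximation N
  have hcancel : ∀ x, f^[q] (g^[q] x) = x := hfg.iterate q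
  have hgab : g^[q] a < g^[q] b := hg.iterate q hab
  have hderiv := hasDerivAt_iterate_exp_sum_log hf hpos q
  have hcont : Continuous f^[q] := hf.continuous.iterate q
  obtain ⟨ξ, hξ, hξ'⟩ := exists_hasDerivAt_eq_slope f^[q] _ hab hcont.continuousOn
    fun x _ => hderiv x
  obtain ⟨η, hη, hη'⟩ := exists_hasDerivAt_eq_slope f^[q] _ hgab hcont.continuousOn
    fun x _ => hderiv x
  rw [hcancel, hcancel] at hη'
  have hconst : ∀ {x y z : ℝ}, F x = F y → z ∈ Ioo x y → F z = F x := fun hxy hz =>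
    le_antisymm (hxy ▸ F.monotone hz.2.le) (F.monotone hz.1.le)
  have hξη : F ξ = F η + q * ρ := by
    rw [hconst hFab hξ, hconst (by simp only [F.iterate_of_semiconj hG, hFab]) hη,
      F.iterate_of_semiconj hG]
    ring
  have hne : q * ρ - p ≠ 0 :=
    sub_ne_zero.2 ((hρ.natCast_mul (Nat.zero_lt_of_lt hNq).ne').ne_int p)
  have hdist := (abs_le.1 (F.abs_sum_sub_sum_le hF hper hφ hne hqp hgap hξη)).1
  have hexp := Real.exp_le_exp.2 hdist
  rw [Real.exp_sub, hξ', hη', ← hC] at hexp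
  refine (hN q hNq.le).not_ge ?_
  have h₁ : 0 < b - a := sub_pos.2 hab
  have h₂ : 0 < g^[q] b - g^[q] a := sub_pos.2 hgab
  calc Real.exp (-C) * (b - a) ^ 2
      ≤ (f^[q] b - f^[q] a) / (b - a) / ((b - a) / (g^[q] b - g^[q] a)) * (b - a) ^ 2 := by gcongr
    _ = (f^[q] b - f^[q] a) * (g^[q] b - g^[q] a) := by field_simp

/-- **Denjoy's theorem.** If `f` is an orientation-preserving circle diffeomorphism with
irrational rotation number `ρ` and `log Df` has bounded variation (e.g. `f` of class `C²`),
then `f` is topologically conjugate to the rotation by `ρ`: there is a lift `H` of a circle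
homeomorphism with `H ∘ f = H + ρ`. -/
theorem denjoy (f : C1CircleDiffeoLift) (ρ : ℝ)
    (hρ : IsRotNumber f.toFun ρ) (hirr : Irrational ρ)
    (hBV : BoundedVariationOn (fun x => Real.log (deriv f.toFun x)) (Set.Icc 0 1)) :
    ∃ H : ℝ → ℝ, Continuous H ∧ StrictMono H ∧ (∀ x, H (x + 1) = H x + 1) ∧
      ∀ x, H (f.toFun x) = H x + ρ := by
  have hdiff : Differentiable ℝ f.toFun := f.contDiff.differentiable one_ne_zero
  have hmono : StrictMono f.toFun := strictMono_of_deriv_pos f.deriv_pos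
  let f' : CircleDeg1Lift := ⟨⟨f.toFun, hmono.monotone⟩, f.map_add_one⟩
  have hsurj : Function.Surjective f.toFun := f'.continuous_iff_surjective.1 hdiff.continuous
  have hτ : f'.translationNumber = ρ := by
    refine tendsto_nhds_unique (f'.tendsto_translationNumber 0) ?_
    simp only [CircleDeg1Lift.coe_pow]
    exact hρ 0
  obtain ⟨F, hF⟩ := CircleDeg1Lift.semiconj_of_bijective_of_translationNumber_eq
    (f₁ := f') (f₂ := CircleDeg1Lift.translate (Multiplicative.ofAdd ρ))
    ⟨hmono.injective, hsurj⟩ (CircleDeg1Lift.isUnit_iff_bijective.1 (Units.isUnit _))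
    (by rw [hτ, CircleDeg1Lift.translationNumber_translate])
  have hFf : ∀ x, F (f.toFun x) = F x + ρ := fun x => by
    rw [add_comm]
    exact hF x
  have hper : Function.Periodic (fun x => Real.log (deriv f.toFun x)) 1 := fun x => by
    have h : deriv (fun y => f.toFun (y + 1)) x = deriv f.toFun x := by
      simp only [f.map_add_one, deriv_add_const]
    rw [deriv_comp_add_const] at h
    simp only [h]
  exact ⟨F, F.continuous_of_semiconj hirr hsurj hFf,
    F.strictMono_of_semiconj hirr hdiff f.deriv_pos hsurj hFf hper
      (hper.boundedVariationOn_Icc_zero_two hBV), F.map_add_one, hFf⟩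
end

section
/- (Yoccoz) There exists ν₀ > 0 such that: if f is an orientation-preserving analytic circle diffeomorphism with rotation number ρ(f) = α satisfying the Brjuno condition, and f extends holomorphically and injectively to the strip T_ν with ν ≥ (1/(2π)) B(α) + ν₀, where B is the Brjuno function, then f is conjugated to the rotation T_α by an analytic circle diffeomorphism. -/
open Filter Topology

/-- Iterates of the Gauss map `G(x) = {1/x}`, starting from the fractional part of `α`:
`α₀ = {α}`, `α_{n+1} = {1/α_n}`. -/
noncomputable def gaussIter (α : ℝ) : ℕ → ℝ
  | 0 => Int.fract α
  | n + 1 => Int.fract (gaussIter α n)⁻¹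

/-- The `(n+1)`-st partial quotient `a_{n+1} = ⌊1/α_n⌋` of the continued fraction of `α`. -/
noncomputable def cfa (α : ℝ) (n : ℕ) : ℕ := ⌊(gaussIter α n)⁻¹⌋₊

/-- The denominators `q_n` of the convergents of `α`: `q₀ = 1`, `q₁ = a₁`,
`q_{n+2} = a_{n+2} q_{n+1} + q_n`. -/
noncomputable def qden (α : ℝ) : ℕ → ℕ
  | 0 => 1
  | 1 => cfa α 0
  | n + 2 => cfa α (n + 1) * qden α (n + 1) + qden α n

/-- The Brjuno condition: `Σ_n log(q_{n+1})/q_n < ∞`. -/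
def IsBrjuno (α : ℝ) : Prop :=
  Summable fun n : ℕ => Real.log (qden α (n + 1)) / (qden α n : ℝ)

/-- The Brjuno function `B(α) = Σ_{n≥0} (α₀ ⋯ α_{n-1}) log(1/α_n)` (with values in
`[0,∞]`), the `1`-periodic solution of `B(x) = x B({1/x}) + log(1/x)` on `(0,1)`;
`α` is a Brjuno number iff `B(α) < ∞`. -/
noncomputable def brjunoFunction (α : ℝ) : ENNReal :=
  ∑' n : ℕ, ENNReal.ofReal
    ((∏ k ∈ Finset.range n, gaussIter α k) * Real.log (gaussIter α n)⁻¹)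

/-- (A lift of) an orientation-preserving analytic circle diffeomorphism extending
holomorphically and injectively to the strip `T_ν = {|Im z| ≤ ν}/ℤ`. -/
structure AnalyticCircleDiffeo (ν : ℝ) where
  toFun : ℂ → ℂ
  diffOn : DifferentiableOn ℂ toFun {z : ℂ | |z.im| ≤ ν}
  injOn : Set.InjOn toFun {z : ℂ | |z.im| ≤ ν}
  real_toFun : ∀ x : ℝ, (toFun x).im = 0
  map_add_one : ∀ z, toFun (z + 1) = toFun z + 1
  strictMono_real : StrictMono fun x : ℝ => (toFun x).re

section Arithmetic

lemma irrational_gaussIter {α : ℝ} (hα : Irrational α) (n : ℕ) :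
    Irrational (gaussIter α n) := by
  induction n with
  | zero =>
    have := hα.sub_intCast ⌊α⌋
    exact this
  | succ n ih =>
    have := (irrational_inv_iff.2 ih).sub_intCast ⌊(gaussIter α n)⁻¹⌋
    exact this

lemma gaussIter_pos {α : ℝ} (hα : Irrational α) (n : ℕ) : 0 < gaussIter α n := by
  have h0 : 0 ≤ gaussIter α n := by cases n <;> exact Int.fract_nonneg _
  exact lt_of_le_of_ne h0 fun h => (irrational_gaussIter hα n).ne_zero h.symm

lemma gaussIter_lt_one (α : ℝ) (n : ℕ) : gaussIter α n < 1 := by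
  cases n <;> exact Int.fract_lt_one _

lemma inv_gaussIter {α : ℝ} (hα : Irrational α) (n : ℕ) :
    (gaussIter α n)⁻¹ = cfa α n + gaussIter α (n + 1) := by
  have h : (cfa α n : ℝ) = (⌊(gaussIter α n)⁻¹⌋ : ℝ) := by
    rw [cfa, natCast_floor_eq_intCast_floor (inv_nonneg.2 (gaussIter_pos hα n).le)]
  rw [h]
  exact (Int.floor_add_fract _).symm

lemma one_le_cfa {α : ℝ} (hα : Irrational α) (n : ℕ) : 1 ≤ cfa α n := by
  rw [cfa, Nat.one_le_floor_iff]
  exact (one_le_inv₀ (gaussIter_pos hα n)).2 (gaussIter_lt_one α n).le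

/-- The products `α₀ ⋯ α_{n-1}`. -/
noncomputable def gaussProd (α : ℝ) (n : ℕ) : ℝ := ∏ k ∈ Finset.range n, gaussIter α k

lemma gaussProd_succ (α : ℝ) (n : ℕ) :
    gaussProd α (n + 1) = gaussProd α n * gaussIter α n := Finset.prod_range_succ _ _

lemma gaussProd_pos {α : ℝ} (hα : Irrational α) (n : ℕ) : 0 < gaussProd α n :=
  Finset.prod_pos fun k _ => gaussIter_pos hα k

lemma gaussProd_succ_le {α : ℝ} (hα : Irrational α) (n : ℕ) :
    gaussProd α (n + 1) ≤ gaussProd α n := by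
  rw [gaussProd_succ]
  exact mul_le_of_le_one_right (gaussProd_pos hα n).le (gaussIter_lt_one α n).le

lemma gaussProd_recurrence {α : ℝ} (hα : Irrational α) (n : ℕ) :
    gaussProd α n = cfa α n * gaussProd α (n + 1) + gaussProd α (n + 2) := by
  have h := inv_gaussIter hα n
  have hp := gaussIter_pos hα n
  rw [gaussProd_succ α (n + 1), gaussProd_succ α n]
  have : gaussIter α n * (cfa α n + gaussIter α (n + 1)) = 1 := by
    rw [← h]; exact mul_inv_cancel₀ hp.ne'
  linear_combination -gaussProd α n * this

lemma qden_add_two (α : ℝ) (n : ℕ) :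
    qden α (n + 2) = cfa α (n + 1) * qden α (n + 1) + qden α n := rfl

lemma qden_pos {α : ℝ} (hα : Irrational α) (n : ℕ) : 1 ≤ qden α n := by
  induction n using Nat.twoStepInduction with
  | zero => exact le_rfl
  | one => exact one_le_cfa hα 0
  | more n h1 _ => rw [qden_add_two]; omega

lemma qden_le_succ {α : ℝ} (hα : Irrational α) (n : ℕ) : qden α n ≤ qden α (n + 1) := by
  cases n with
  | zero => exact one_le_cfa hα 0
  | succ n =>
    rw [qden_add_two]
    nlinarith [one_le_cfa hα (n + 1), Nat.zero_le (qden α n), Nat.zero_le (qden α (n + 1))]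

lemma two_mul_qden_le {α : ℝ} (hα : Irrational α) (n : ℕ) :
    2 * qden α n ≤ qden α (n + 2) := by
  rw [qden_add_two]
  nlinarith [one_le_cfa hα (n + 1), qden_le_succ hα n]

lemma two_pow_le_qden_sq {α : ℝ} (hα : Irrational α) (n : ℕ) :
    2 ^ n ≤ 2 * qden α n ^ 2 := by
  induction n using Nat.twoStepInduction with
  | zero => simp [qden]
  | one => nlinarith [qden_pos hα 1]
  | more n h1 _ =>
    have := two_mul_qden_le hα n
    calc 2 ^ (n + 2) = 4 * 2 ^ n := by ring
      _ ≤ 4 * (2 * qden α n ^ 2) := by omega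
      _ = 2 * (2 * qden α n) ^ 2 := by ring
      _ ≤ _ := by gcongr

lemma qden_mul_gaussProd {α : ℝ} (hα : Irrational α) (n : ℕ) :
    qden α (n + 1) * gaussProd α (n + 1) + qden α n * gaussProd α (n + 2) = 1 := by
  induction n with
  | zero =>
    have := gaussProd_recurrence hα 0
    simp only [qden, gaussProd, Finset.range_zero, Finset.prod_empty] at this ⊢
    push_cast
    linarith
  | succ n ih =>
    rw [qden_add_two]
    push_cast
    have := gaussProd_recurrence hα (n + 1)
    linear_combination ih - (qden α (n + 1) : ℝ) * this

lemma gaussProd_le {α : ℝ} (hα : Irrational α) (n : ℕ) :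
    gaussProd α n ≤ (qden α n : ℝ)⁻¹ := by
  cases n with
  | zero => simp [gaussProd, qden]
  | succ n =>
    have h := qden_mul_gaussProd hα n
    have hq : (0 : ℝ) < qden α (n + 1) := by exact_mod_cast qden_pos hα (n + 1)
    rw [le_inv_comm₀ (gaussProd_pos hα _) hq, ← one_div, le_div_iff₀ (gaussProd_pos hα _)]
    have : 0 ≤ qden α n * gaussProd α (n + 2) :=
      mul_nonneg (Nat.cast_nonneg _) (gaussProd_pos hα _).le
    linarith

lemma inv_le_gaussProd {α : ℝ} (hα : Irrational α) (n : ℕ) :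
    (2 * qden α n : ℝ)⁻¹ ≤ gaussProd α n := by
  cases n with
  | zero => norm_num [gaussProd, qden]
  | succ n =>
    have h := qden_mul_gaussProd hα n
    have hq : (0 : ℝ) < qden α (n + 1) := by exact_mod_cast qden_pos hα (n + 1)
    have h1 : (qden α n : ℝ) ≤ qden α (n + 1) := by exact_mod_cast qden_le_succ hα n
    have h2 := gaussProd_succ_le hα (n + 1)
    have h3 : qden α n * gaussProd α (n + 2) ≤ qden α (n + 1) * gaussProd α (n + 1) :=
      mul_le_mul h1 h2 (gaussProd_pos hα _).le hq.le
    rw [inv_le_iff_one_le_mul₀ (by positivity)]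
    linarith

/-- The numerators of the convergents of the fractional part of `α`. -/
noncomputable def pnum (α : ℝ) : ℕ → ℕ
  | 0 => 0
  | 1 => 1
  | n + 2 => cfa α (n + 1) * pnum α (n + 1) + pnum α n

lemma qden_mul_fract_sub {α : ℝ} (hα : Irrational α) (n : ℕ) :
    qden α n * Int.fract α - pnum α n = (-1) ^ n * gaussProd α (n + 1) := by
  induction n using Nat.twoStepInduction with
  | zero => simp [qden, pnum, gaussProd, gaussIter]
  | one =>
    have := gaussProd_recurrence hα 0
    simp only [qden, pnum, gaussProd, Finset.range_zero, Finset.prod_empty, zero_add,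
      Finset.prod_range_one, gaussIter] at this ⊢
    push_cast
    linarith
  | more n h1 h2 =>
    have := gaussProd_recurrence hα (n + 1)
    simp only [qden, pnum]
    push_cast
    have e : ((-1 : ℝ)) ^ (n + 2) = (-1) ^ n := by ring
    have e1 : ((-1 : ℝ)) ^ (n + 1) = -(-1) ^ n := by ring
    rw [e1] at h2
    rw [e]
    linear_combination (cfa α (n + 1) : ℝ) * h2 + h1 + (-1 : ℝ) ^ n * this

lemma qden_pnum_det (α : ℝ) (n : ℕ) :
    (qden α (n + 1) : ℤ) * pnum α n - pnum α (n + 1) * qden α n = (-1) ^ (n + 1) := by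
  induction n with
  | zero => simp [qden, pnum]
  | succ n ih =>
    simp only [qden, pnum] at ih ⊢
    push_cast
    have e : ((-1 : ℤ)) ^ (n + 1 + 1) = -(-1) ^ (n + 1) := by ring
    rw [e]
    linear_combination -ih

/-- The best approximation property of the convergents. -/
lemma gaussProd_le_abs_sub {α : ℝ} (hα : Irrational α) (n : ℕ) {k : ℤ} (hk : k ≠ 0)
    (hkn : |k| < qden α n) (l : ℤ) : gaussProd α n ≤ |k * Int.fract α - l| := by
  cases n with
  | zero =>
    have : |k| < 1 := by simpa [qden] using hkn
    exact absurd (Int.abs_lt_one_iff.1 this) hk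
  | succ n =>
    have hdet := qden_pnum_det α n
    set e : ℤ := (-1) ^ (n + 1) with he
    have hee : e * e = 1 := by rw [he, ← pow_add]; exact Even.neg_one_pow ⟨n + 1, rfl⟩
    set x : ℤ := e * (qden α (n + 1) * l - pnum α (n + 1) * k) with hx
    set y : ℤ := e * (pnum α n * k - qden α n * l) with hy
    have hkxy : k = x * qden α n + y * qden α (n + 1) := by
      rw [hx, hy]
      linear_combination (-k) * hee + (-e * k) * hdet
    have hlxy : l = x * pnum α n + y * pnum α (n + 1) := by
      rw [hx, hy]
      linear_combination (-l) * hee + (-e * l) * hdet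
    have hq0 : (1 : ℤ) ≤ qden α n := by exact_mod_cast qden_pos hα n
    have hq1 : (1 : ℤ) ≤ qden α (n + 1) := by exact_mod_cast qden_pos hα (n + 1)
    have hval : (k : ℝ) * Int.fract α - l =
        (-1) ^ n * (x * gaussProd α (n + 1) - y * gaussProd α (n + 2)) := by
      have h0 := qden_mul_fract_sub hα n
      have h1 := qden_mul_fract_sub hα (n + 1)
      have e1 : ((-1 : ℝ)) ^ (n + 1) = -(-1) ^ n := by ring
      rw [e1] at h1
      rw [hkxy, hlxy]
      push_cast
      linear_combination (x : ℝ) * h0 + (y : ℝ) * h1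
    rw [hval, abs_mul, abs_pow, abs_neg, abs_one, one_pow, one_mul]
    have b1 := gaussProd_pos hα (n + 1)
    have b2 := gaussProd_pos hα (n + 2)
    rw [abs_lt] at hkn
    rcases lt_trichotomy x 0 with hx0 | hx0 | hx0
    · have hy0 : 0 ≤ y := by
        by_contra hy0
        nlinarith
      have h1 : (x : ℝ) ≤ -1 := by exact_mod_cast Int.le_sub_one_of_lt hx0
      have h2 : (0 : ℝ) ≤ y := by exact_mod_cast hy0
      rw [abs_of_nonpos (by nlinarith)]
      nlinarith
    · exfalso
      rw [hx0, zero_mul, zero_add] at hkxy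
      have : y ≠ 0 := by rintro h; rw [h] at hkxy; simp at hkxy; exact hk hkxy
      rcases lt_or_gt_of_ne this with h | h <;> nlinarith
    · have hy0 : y ≤ 0 := by
        by_contra hy0
        nlinarith
      have h1 : (1 : ℝ) ≤ x := by exact_mod_cast hx0
      have h2 : (y : ℝ) ≤ 0 := by exact_mod_cast hy0
      rw [abs_of_nonneg (by nlinarith)]
      nlinarith

/-- The small divisor estimate: frequencies below `q_n`. -/
lemma smallDivisor_le {α : ℝ} (hα : Irrational α) (n : ℕ) {k : ℤ} (hk : k ≠ 0)
    (hkn : |k| < qden α n) :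
    1 ≤ qden α n * ‖Complex.exp (2 * Real.pi * Complex.I * k * α) - 1‖ := by
  have hq : (0 : ℝ) < qden α n := by exact_mod_cast qden_pos hα n
  set t : ℝ := k * α with ht
  have hexp : Complex.exp (2 * Real.pi * Complex.I * k * α) =
      Complex.exp (Complex.I * (2 * Real.pi * (t - round t) : ℝ)) := by
    rw [Complex.exp_eq_exp_iff_exists_int]
    refine ⟨round t, ?_⟩
    rw [ht]; push_cast; ring
  rw [hexp, Complex.norm_exp_I_mul_ofReal_sub_one]
  have habs : |t - round t| ≤ 1 / 2 := abs_sub_round t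
  have hsin : 2 / Real.pi * |2 * Real.pi * (t - round t) / 2| ≤
      |Real.sin (2 * Real.pi * (t - round t) / 2)| := by
    apply Real.mul_abs_le_abs_sin
    rw [show 2 * Real.pi * (t - round t) / 2 = Real.pi * (t - round t) by ring, abs_mul,
      abs_of_pos Real.pi_pos]
    nlinarith [Real.pi_pos]
  have hd : gaussProd α n ≤ |t - round t| := by
    have := gaussProd_le_abs_sub hα n hk hkn (round t - k * ⌊α⌋)
    convert this using 2
    rw [ht, Int.fract]; push_cast; ring
  have hb := inv_le_gaussProd hα n
  rw [norm_mul, Real.norm_eq_abs, Real.norm_eq_abs, abs_two]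
  have e : 2 / Real.pi * |2 * Real.pi * (t - round t) / 2| = 2 * |t - round t| := by
    rw [show 2 * Real.pi * (t - round t) / 2 = Real.pi * (t - round t) by ring, abs_mul,
      abs_of_pos Real.pi_pos]
    field_simp
  rw [e] at hsin
  have h3 : (2 * qden α n : ℝ)⁻¹ * (2 * qden α n) = 1 := inv_mul_cancel₀ (by positivity)
  nlinarith

/-- A geometric sequence dominating `(log q_n + 1) / q_n` for all irrational numbers. -/
noncomputable def brjunoMajorant (n : ℕ) : ℝ := 12 * (Real.sqrt (Real.sqrt (1 / 2))) ^ n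

lemma summable_brjunoMajorant : Summable brjunoMajorant := by
  refine (summable_geometric_of_lt_one (by positivity) ?_).mul_left 12
  rw [Real.sqrt_lt' one_pos, Real.sqrt_lt' (by norm_num)]
  norm_num

lemma brjunoMajorant_nonneg (n : ℕ) : 0 ≤ brjunoMajorant n := by
  unfold brjunoMajorant; positivity

lemma log_add_one_div_qden_le {α : ℝ} (hα : Irrational α) (n : ℕ) :
    (Real.log (qden α n) + 1) / qden α n ≤ brjunoMajorant n := by
  have hq : (1 : ℝ) ≤ qden α n := by exact_mod_cast qden_pos hα n
  set Q : ℝ := (qden α n : ℝ) with hQ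
  have hs : 1 ≤ Real.sqrt Q := Real.one_le_sqrt.2 hq
  have hlog : Real.log Q ≤ 2 * Real.sqrt Q := by
    have : Real.log Q = 2 * Real.log (Real.sqrt Q) := by
      rw [Real.log_sqrt (by linarith)]; ring
    rw [this]
    linarith [Real.log_le_self (Real.sqrt_nonneg Q)]
  set ρ := Real.sqrt (Real.sqrt (1 / 2)) with hρ
  have hρ0 : 0 < ρ := by positivity
  have hρ4 : ρ ^ 4 = 1 / 2 := by
    rw [show ρ ^ 4 = (ρ ^ 2) ^ 2 by ring, hρ, Real.sq_sqrt (by positivity),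
      Real.sq_sqrt (by norm_num)]
  have hpow : (2 : ℝ) ^ n ≤ 2 * Q ^ 2 := by
    rw [hQ]; exact_mod_cast two_pow_le_qden_sq hα n
  have key : 1 ≤ 2 * (Real.sqrt Q * ρ ^ n) := by
    refine le_of_pow_le_pow_left₀ (n := 4) (by norm_num) (by positivity) ?_
    have e : (2 * (Real.sqrt Q * ρ ^ n)) ^ 4 = 16 * (((Real.sqrt Q) ^ 2) ^ 2 * (ρ ^ 4) ^ n) := by
      rw [← pow_mul ρ 4, mul_comm 4 n, pow_mul]; ring
    rw [e, Real.sq_sqrt (by linarith), hρ4, one_div, inv_pow]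
    have h2 : (0 : ℝ) < 2 ^ n := by positivity
    have : 1 / 2 ≤ Q ^ 2 * ((2 : ℝ) ^ n)⁻¹ := by
      rw [← div_eq_mul_inv, le_div_iff₀ h2]; linarith
    linarith
  rw [div_le_iff₀ (by linarith), brjunoMajorant]
  have hQs : Q = Real.sqrt Q * Real.sqrt Q := (Real.mul_self_sqrt (by linarith)).symm
  calc Real.log Q + 1 ≤ 3 * Real.sqrt Q * 1 := by linarith
    _ ≤ 3 * Real.sqrt Q * (2 * (Real.sqrt Q * ρ ^ n)) := by gcongr
    _ = 6 * ρ ^ n * (Real.sqrt Q * Real.sqrt Q) := by ring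
    _ = 6 * ρ ^ n * Q := by rw [← hQs]
    _ ≤ 12 * ρ ^ n * Q := by
      have : 0 ≤ ρ ^ n * Q := by positivity
      linarith

lemma one_div_qden_le {α : ℝ} (hα : Irrational α) (n : ℕ) :
    1 / (qden α n : ℝ) ≤ brjunoMajorant n := by
  have hq : (1 : ℝ) ≤ qden α n := by exact_mod_cast qden_pos hα n
  refine le_trans ?_ (log_add_one_div_qden_le hα n)
  gcongr
  linarith [Real.log_nonneg hq]

lemma log_qden_div_le {α : ℝ} (hα : Irrational α) (n : ℕ) :
    Real.log (qden α (n + 1)) / qden α n ≤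
      gaussProd α n * Real.log (gaussIter α n)⁻¹ +
        (brjunoMajorant n + brjunoMajorant (n + 1)) := by
  have hq0 : (1 : ℝ) ≤ qden α n := by exact_mod_cast qden_pos hα n
  have hq1 : (1 : ℝ) ≤ qden α (n + 1) := by exact_mod_cast qden_pos hα (n + 1)
  have hb0 := gaussProd_pos hα n
  have hb1 := gaussProd_pos hα (n + 1)
  have hL := Real.log_nonneg hq1
  have h1 : (qden α n : ℝ)⁻¹ ≤ gaussProd α n + (qden α (n + 1) : ℝ)⁻¹ := by
    cases n with
    | zero => simp [gaussProd, qden]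
    | succ n =>
      have h := qden_mul_gaussProd hα n
      have hle := gaussProd_le hα (n + 2)
      have hm : (qden α n : ℝ) ≤ qden α (n + 1) := by exact_mod_cast qden_le_succ hα n
      rw [inv_le_iff_one_le_mul₀ (by linarith)]
      have : (qden α n : ℝ) * gaussProd α (n + 2) ≤
          qden α (n + 1) * (qden α (n + 2) : ℝ)⁻¹ :=
        mul_le_mul hm hle (gaussProd_pos hα _).le (by positivity)
      linarith
  have h2 : Real.log (qden α (n + 1)) ≤
      Real.log (2 * qden α n) + Real.log (gaussIter α n)⁻¹ := by
    have hA := gaussIter_pos hα n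
    rw [← Real.log_mul (by positivity) (by positivity)]
    apply Real.log_le_log (by linarith)
    have e1 := gaussProd_le hα (n + 1)
    have e2 := inv_le_gaussProd hα n
    rw [le_inv_comm₀ hb1 (by linarith)] at e1
    refine e1.trans ?_
    rw [gaussProd_succ, mul_inv]
    have : (gaussProd α n)⁻¹ ≤ 2 * qden α n := by
      rw [inv_le_comm₀ hb0 (by positivity)]; exact e2
    gcongr
  have h3 : gaussProd α n * Real.log (2 * qden α n) ≤ brjunoMajorant n := by
    refine le_trans ?_ (log_add_one_div_qden_le hα n)
    rw [div_eq_inv_mul, Real.log_mul (by norm_num) (by positivity)]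
    have := gaussProd_le hα n
    have l2 : Real.log 2 ≤ 1 := by linarith [Real.log_two_lt_d9]
    have l0 : 0 ≤ Real.log 2 := Real.log_nonneg (by norm_num)
    have l3 := Real.log_nonneg hq0
    exact mul_le_mul this (by linarith) (by linarith) (by positivity)
  have h4 : (qden α (n + 1) : ℝ)⁻¹ * Real.log (qden α (n + 1)) ≤ brjunoMajorant (n + 1) := by
    refine le_trans ?_ (log_add_one_div_qden_le hα (n + 1))
    rw [div_eq_inv_mul]
    gcongr
    linarith
  rw [div_eq_inv_mul]
  have h5 := mul_le_mul_of_nonneg_right h1 hL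
  have h6 := mul_le_mul_of_nonneg_left h2 hb0.le
  linarith

lemma gaussProd_mul_log_nonneg {α : ℝ} (hα : Irrational α) (n : ℕ) :
    0 ≤ gaussProd α n * Real.log (gaussIter α n)⁻¹ :=
  mul_nonneg (gaussProd_pos hα n).le (Real.log_nonneg
    ((one_le_inv₀ (gaussIter_pos hα n)).2 (gaussIter_lt_one α n).le))

lemma summable_gaussProd_mul_log {α : ℝ} (hα : Irrational α) (hB : IsBrjuno α) :
    Summable fun n => gaussProd α n * Real.log (gaussIter α n)⁻¹ := by
  refine Summable.of_nonneg_of_le (gaussProd_mul_log_nonneg hα) (fun n => ?_)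
    (Summable.add hB summable_brjunoMajorant)
  have hq0 : (1 : ℝ) ≤ qden α n := by exact_mod_cast qden_pos hα n
  have hq1 : (1 : ℝ) ≤ qden α (n + 1) := by exact_mod_cast qden_pos hα (n + 1)
  have hA := gaussIter_pos hα n
  have hb0 := gaussProd_pos hα n
  have hb1 := gaussProd_pos hα (n + 1)
  have h1 : Real.log (gaussIter α n)⁻¹ ≤ Real.log (qden α (n + 1)) + 1 := by
    have l2 : Real.log 2 ≤ 1 := by linarith [Real.log_two_lt_d9]
    have : Real.log (gaussIter α n)⁻¹ ≤ Real.log (2 * qden α (n + 1)) := by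
      apply Real.log_le_log (by positivity)
      have e2 := inv_le_gaussProd hα (n + 1)
      rw [inv_le_comm₀ (by positivity) hb1, gaussProd_succ, mul_inv] at e2
      refine le_trans ?_ e2
      apply le_mul_of_one_le_left (by positivity)
      rw [one_le_inv₀ hb0]
      exact (gaussProd_le hα n).trans (inv_le_one_of_one_le₀ hq0)
    rw [Real.log_mul (by norm_num) (by positivity)] at this
    linarith
  have hL := Real.log_nonneg hq1
  calc gaussProd α n * Real.log (gaussIter α n)⁻¹
      ≤ (qden α n : ℝ)⁻¹ * (Real.log (qden α (n + 1)) + 1) :=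
        mul_le_mul (gaussProd_le hα n) h1 (Real.log_nonneg
          ((one_le_inv₀ hA).2 (gaussIter_lt_one α n).le)) (by positivity)
    _ = Real.log (qden α (n + 1)) / qden α n + 1 / qden α n := by
        rw [mul_add, div_eq_inv_mul, one_div, mul_one]
    _ ≤ _ := by gcongr; exact one_div_qden_le hα n

lemma brjunoFunction_toReal {α : ℝ} (hα : Irrational α) (hB : IsBrjuno α) :
    (brjunoFunction α).toReal = ∑' n, gaussProd α n * Real.log (gaussIter α n)⁻¹ := by
  unfold brjunoFunction
  change (∑' n, ENNReal.ofReal (gaussProd α n * Real.log (gaussIter α n)⁻¹)).toReal = _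
  rw [← ENNReal.ofReal_tsum_of_nonneg (gaussProd_mul_log_nonneg hα)
    (summable_gaussProd_mul_log hα hB), ENNReal.toReal_ofReal]
  exact tsum_nonneg (gaussProd_mul_log_nonneg hα)

/-- The Brjuno sum is bounded by the Brjuno function up to a universal additive constant. -/
lemma sum_log_qden_div_le {α : ℝ} (hα : Irrational α) (hB : IsBrjuno α) (M : ℕ) :
    ∑ n ∈ Finset.range M, (Real.log (qden α (n + 1)) + Real.log 8) / qden α n ≤
      (brjunoFunction α).toReal + 5 * ∑' n, brjunoMajorant n := by
  have hS := summable_brjunoMajorant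
  have hS1 : Summable fun n => brjunoMajorant (n + 1) := (summable_nat_add_iff 1).2 hS
  have hG := summable_gaussProd_mul_log hα hB
  have h8 : Real.log 8 ≤ 3 := by
    rw [show (8 : ℝ) = 2 ^ 3 by norm_num, Real.log_pow]
    push_cast
    linarith [Real.log_two_lt_d9]
  calc ∑ n ∈ Finset.range M, (Real.log (qden α (n + 1)) + Real.log 8) / qden α n
      ≤ ∑ n ∈ Finset.range M, (gaussProd α n * Real.log (gaussIter α n)⁻¹ +
          (4 * brjunoMajorant n + brjunoMajorant (n + 1))) := by
        refine Finset.sum_le_sum fun n _ => ?_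
        have h1 := log_qden_div_le hα n
        have h2 := one_div_qden_le hα n
        rw [add_div]
        have h3 : Real.log 8 / qden α n ≤ 3 * (1 / qden α n) := by
          rw [mul_one_div]; gcongr
        linarith
    _ ≤ ∑' n, (gaussProd α n * Real.log (gaussIter α n)⁻¹ +
          (4 * brjunoMajorant n + brjunoMajorant (n + 1))) := by
        refine (hG.add ((hS.mul_left 4).add hS1)).sum_le_tsum _ fun n _ => ?_
        have := gaussProd_mul_log_nonneg hα n
        have := brjunoMajorant_nonneg n
        have := brjunoMajorant_nonneg (n + 1)
        linarith
    _ = (brjunoFunction α).toReal +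
          (4 * ∑' n, brjunoMajorant n + ∑' n, brjunoMajorant (n + 1)) := by
        rw [hG.tsum_add ((hS.mul_left 4).add hS1), (hS.mul_left 4).tsum_add hS1, tsum_mul_left,
          brjunoFunction_toReal hα hB]
    _ ≤ _ := by
        have := hS.tsum_eq_zero_add
        have := brjunoMajorant_nonneg 0
        linarith

end Arithmetic

section Wiener

/-- The Fourier mode `z ↦ exp (2πikz)`. -/
noncomputable def fmode (k : ℤ) (z : ℂ) : ℂ := Complex.exp (2 * Real.pi * Complex.I * k * z)

/-- The weight of the `k`-th Fourier mode on the strip `|Im z| ≤ r`. -/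
noncomputable def fweight (k : ℤ) (r : ℝ) : ℝ := Real.exp (2 * Real.pi * |(k : ℝ)| * r)

lemma fweight_pos (k : ℤ) (r : ℝ) : 0 < fweight k r := Real.exp_pos _

lemma fweight_mono (k : ℤ) {r s : ℝ} (h : r ≤ s) : fweight k r ≤ fweight k s := by
  unfold fweight; gcongr

lemma fweight_add (k : ℤ) (r s : ℝ) : fweight k (r + s) = fweight k r * fweight k s := by
  rw [fweight, fweight, fweight, ← Real.exp_add]; ring_nf

lemma fmode_add (k : ℤ) (z w : ℂ) : fmode k (z + w) = fmode k z * fmode k w := by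
  rw [fmode, fmode, fmode, ← Complex.exp_add]; ring_nf

lemma fmode_add_index (k l : ℤ) (z : ℂ) : fmode (k + l) z = fmode k z * fmode l z := by
  rw [fmode, fmode, fmode, ← Complex.exp_add]; push_cast; ring_nf

lemma fmode_zero (z : ℂ) : fmode 0 z = 1 := by simp [fmode]

lemma fmode_one (k : ℤ) : fmode k 1 = 1 := by
  rw [fmode, Complex.exp_eq_one_iff]
  exact ⟨k, by ring⟩

lemma norm_fmode (k : ℤ) (z : ℂ) : ‖fmode k z‖ = Real.exp (-(2 * Real.pi * k * z.im)) := by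
  rw [fmode, Complex.norm_exp]
  congr 1
  simp

lemma norm_fmode_le (k : ℤ) {z : ℂ} {r : ℝ} (hz : |z.im| ≤ r) : ‖fmode k z‖ ≤ fweight k r := by
  rw [norm_fmode, fweight, Real.exp_le_exp]
  have h1 : |(k : ℝ) * z.im| ≤ |(k : ℝ)| * r := by
    rw [abs_mul]; gcongr
  have h2 := neg_abs_le ((k : ℝ) * z.im)
  nlinarith [Real.pi_pos]

lemma norm_fmode_ofReal (k : ℤ) (x : ℝ) : ‖fmode k x‖ = 1 := by
  rw [norm_fmode]; simp

/-- `g` has, on the strip `|Im z| ≤ r`, an expansion in Fourier modes (with repetitions allowed)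
of weighted `ℓ¹` norm at most `ε`. -/
def WienerOn (r ε : ℝ) (g : ℂ → ℂ) : Prop :=
  ∃ (ι : Type) (a : ι → ℂ) (k : ι → ℤ), (∃ S ≤ ε, HasSum (fun i => ‖a i‖ * fweight (k i) r) S) ∧
    ∀ z : ℂ, |z.im| ≤ r → HasSum (fun i => a i * fmode (k i) z) (g z)

namespace WienerOn

variable {r r' ρ ε ε' s t δ : ℝ} {g g' : ℂ → ℂ}

lemma congr (h : WienerOn r ε g) (hg : ∀ z : ℂ, |z.im| ≤ r → g z = g' z) :
    WienerOn r ε g' := by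
  obtain ⟨ι, a, k, hS, h⟩ := h
  exact ⟨ι, a, k, hS, fun z hz => hg z hz ▸ h z hz⟩

lemma nonneg (h : WienerOn r ε g) : 0 ≤ ε := by
  obtain ⟨ι, a, k, ⟨S, hSε, hS⟩, -⟩ := h
  exact (hS.nonneg fun i => mul_nonneg (norm_nonneg _) (fweight_pos _ _).le).trans hSε

lemma mono_right (h : WienerOn r ε g) (hε : ε ≤ ε') : WienerOn r ε' g := by
  obtain ⟨ι, a, k, ⟨S, hSε, hS⟩, h⟩ := h
  exact ⟨ι, a, k, ⟨S, hSε.trans hε, hS⟩, h⟩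

lemma mono_left (h : WienerOn r ε g) (hr : r' ≤ r) : WienerOn r' ε g := by
  obtain ⟨ι, a, k, ⟨S, hSε, hS⟩, h⟩ := h
  have hle : ∀ i, ‖a i‖ * fweight (k i) r' ≤ ‖a i‖ * fweight (k i) r := fun i =>
    mul_le_mul_of_nonneg_left (fweight_mono _ hr) (norm_nonneg _)
  have hs := Summable.of_nonneg_of_le
    (fun i => mul_nonneg (norm_nonneg _) (fweight_pos _ _).le) hle hS.summable
  exact ⟨ι, a, k, ⟨_, (hasSum_le hle hs.hasSum hS).trans hSε, hs.hasSum⟩,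
    fun z hz => h z (hz.trans hr)⟩

lemma norm_le (h : WienerOn r ε g) {z : ℂ} (hz : |z.im| ≤ r) : ‖g z‖ ≤ ε := by
  obtain ⟨ι, a, k, ⟨S, hSε, hS⟩, h⟩ := h
  refine le_trans ?_ hSε
  rw [← (h z hz).tsum_eq]
  refine tsum_of_norm_bounded hS fun i => ?_
  rw [norm_mul]
  exact mul_le_mul_of_nonneg_left (norm_fmode_le _ hz) (norm_nonneg _)

lemma term (a : ℂ) (k : ℤ) (r : ℝ) : WienerOn r (‖a‖ * fweight k r) (fun z => a * fmode k z) :=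
  ⟨Unit, fun _ => a, fun _ => k, ⟨_, le_rfl, hasSum_unique _⟩, fun _ _ => hasSum_unique _⟩

lemma const (a : ℂ) (r : ℝ) : WienerOn r ‖a‖ (fun _ => a) := by
  simpa [fmode_zero, fweight] using term a 0 r

lemma tsum {κ : Type} {g : κ → ℂ → ℂ} {ε : κ → ℝ} (h : ∀ j, WienerOn r (ε j) (g j))
    (hε : Summable ε) : WienerOn r (∑' j, ε j) (fun z => ∑' j, g j z) := by
  choose ι a k hS hg using h
  choose S hSε hS using hS
  have hS0 : ∀ j, 0 ≤ S j := fun j =>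
    (hS j).nonneg fun i => mul_nonneg (norm_nonneg _) (fweight_pos _ _).le
  have hSs : Summable S := Summable.of_nonneg_of_le hS0 hSε hε
  have hsig : Summable fun p : Σ j, ι j => ‖a p.1 p.2‖ * fweight (k p.1 p.2) r := by
    rw [summable_sigma_of_nonneg
      fun p => mul_nonneg (norm_nonneg _) (fweight_pos _ _).le]
    refine ⟨fun j => (hS j).summable, ?_⟩
    simpa only [(hS _).tsum_eq] using hSs
  refine ⟨Σ j, ι j, fun p => a p.1 p.2, fun p => k p.1 p.2, ⟨_, ?_, hsig.hasSum⟩,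
    fun z hz => ?_⟩
  · rw [hsig.tsum_sigma' fun j => (hS j).summable]
    simp only [(hS _).tsum_eq]
    exact hSs.tsum_le_tsum hSε hε
  · have hn : Summable fun p : Σ j, ι j => a p.1 p.2 * fmode (k p.1 p.2) z := by
      refine Summable.of_norm_bounded hsig fun p => ?_
      rw [norm_mul]
      exact mul_le_mul_of_nonneg_left (norm_fmode_le _ hz) (norm_nonneg _)
    have hsum := hn.hasSum.sigma (g := fun j => g j z) fun j => hg j z hz
    simpa only [hsum.tsum_eq] using hn.hasSum

lemma add (h : WienerOn r ε g) (h' : WienerOn r ε' g') :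
    WienerOn r (ε + ε') (fun z => g z + g' z) := by
  have := tsum (κ := Bool) (r := r) (g := fun b => cond b g g') (ε := fun b => cond b ε ε')
    (by rintro (_ | _) <;> assumption) Summable.of_finite
  simpa [tsum_fintype] using this

lemma mul (hr : 0 ≤ r) (h : WienerOn r ε g) (h' : WienerOn r ε' g') :
    WienerOn r (ε * ε') (fun z => g z * g' z) := by
  have hε0 := h.nonneg
  obtain ⟨ι, a, k, ⟨S, hSε, hS⟩, hg⟩ := h
  obtain ⟨ι', a', k', ⟨S', hSε', hS'⟩, hg'⟩ := h'
  have h0 : ∀ i, 0 ≤ ‖a i‖ * fweight (k i) r :=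
    fun i => mul_nonneg (norm_nonneg _) (fweight_pos _ _).le
  have h0' : ∀ i, 0 ≤ ‖a' i‖ * fweight (k' i) r :=
    fun i => mul_nonneg (norm_nonneg _) (fweight_pos _ _).le
  have hprod := hS.mul hS' (hS.summable.mul_of_nonneg hS'.summable h0 h0')
  have hle : ∀ p : ι × ι', ‖a p.1 * a' p.2‖ * fweight (k p.1 + k' p.2) r ≤
      ‖a p.1‖ * fweight (k p.1) r * (‖a' p.2‖ * fweight (k' p.2) r) := by
    intro p
    have : fweight (k p.1 + k' p.2) r ≤ fweight (k p.1) r * fweight (k' p.2) r := by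
      rw [fweight, fweight, fweight, ← Real.exp_add, Real.exp_le_exp]
      push_cast
      have := mul_le_mul_of_nonneg_right (abs_add_le (k p.1 : ℝ) (k' p.2)) hr
      nlinarith [Real.pi_pos]
    rw [norm_mul]
    calc _ ≤ ‖a p.1‖ * ‖a' p.2‖ * (fweight (k p.1) r * fweight (k' p.2) r) := by gcongr
      _ = _ := by ring
  have hs := Summable.of_nonneg_of_le
    (fun p => mul_nonneg (norm_nonneg _) (fweight_pos _ _).le) hle hprod.summable
  refine ⟨ι × ι', fun p => a p.1 * a' p.2, fun p => k p.1 + k' p.2,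
    ⟨_, (hasSum_le hle hs.hasSum hprod).trans ?_, hs.hasSum⟩, fun z hz => ?_⟩
  · exact mul_le_mul hSε hSε' (hS'.nonneg h0') hε0
  · have hb : ∀ (b : ℂ) (l : ℤ), ‖b * fmode l z‖ ≤ ‖b‖ * fweight l r := fun b l => by
      rw [norm_mul]
      exact mul_le_mul_of_nonneg_left (norm_fmode_le _ hz) (norm_nonneg _)
    have n1 : Summable fun i => ‖a i * fmode (k i) z‖ :=
      Summable.of_nonneg_of_le (fun _ => norm_nonneg _) (fun i => hb _ _) hS.summable
    have n2 : Summable fun i => ‖a' i * fmode (k' i) z‖ :=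
      Summable.of_nonneg_of_le (fun _ => norm_nonneg _) (fun i => hb _ _) hS'.summable
    have n3 : Summable fun p : ι × ι' => a p.1 * fmode (k p.1) z * (a' p.2 * fmode (k' p.2) z) :=
      summable_mul_of_summable_norm (f := fun i => a i * fmode (k i) z)
        (g := fun i => a' i * fmode (k' i) z) n1 n2
    have hm := (hg z hz).mul (hg' z hz) n3
    have e : (fun p : ι × ι' => a p.1 * a' p.2 * fmode (k p.1 + k' p.2) z) =
        fun p => a p.1 * fmode (k p.1) z * (a' p.2 * fmode (k' p.2) z) := by
      funext p
      rw [fmode_add_index]; ring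
    rwa [e]

lemma const_mul (hr : 0 ≤ r) (h : WienerOn r ε g) (c : ℂ) :
    WienerOn r (‖c‖ * ε) (fun z => c * g z) := mul hr (const c r) h

lemma neg (hr : 0 ≤ r) (h : WienerOn r ε g) : WienerOn r ε (fun z => -g z) := by
  simpa using h.const_mul hr (-1)

lemma pow (hr : 0 ≤ r) (h : WienerOn r ε g) (n : ℕ) :
    WienerOn r (ε ^ n) (fun z => g z ^ n) := by
  induction n with
  | zero => simpa using const 1 r
  | succ n ih => simpa [pow_succ] using mul hr ih h

lemma exp_sub_one (hr : 0 ≤ r) (h : WienerOn r ε g) :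
    WienerOn r (Real.exp ε - 1) (fun z => Complex.exp (g z) - 1) := by
  have hterm : ∀ n : ℕ, WienerOn r (ε ^ (n + 1) / (n + 1).factorial)
      (fun z => g z ^ (n + 1) / (n + 1).factorial) := fun n => by
    have := (h.pow hr (n + 1)).const_mul hr (((n + 1).factorial : ℂ)⁻¹)
    rw [norm_inv, Complex.norm_natCast] at this
    simpa only [div_eq_inv_mul] using this
  have hR : HasSum (fun n : ℕ => ε ^ (n + 1) / (n + 1).factorial) (Real.exp ε - 1) := by
    have := NormedSpace.expSeries_div_hasSum_exp ε
    rw [← Real.exp_eq_exp_ℝ, ← hasSum_nat_add_iff' 1] at this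
    simpa using this
  have hC : ∀ w : ℂ, HasSum (fun n : ℕ => w ^ (n + 1) / (n + 1).factorial)
      (Complex.exp w - 1) := fun w => by
    have := NormedSpace.expSeries_div_hasSum_exp w
    rw [← Complex.exp_eq_exp_ℂ, ← hasSum_nat_add_iff' 1] at this
    simpa using this
  have := tsum hterm hR.summable
  rw [hR.tsum_eq] at this
  exact this.congr fun z _ => (hC (g z)).tsum_eq

lemma fmode_sub_one (hr : 0 ≤ r) (h : WienerOn r ε g) (k : ℤ) :
    WienerOn r (fweight k ε - 1) (fun z => fmode k (g z) - 1) := by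
  have := (h.const_mul hr (2 * Real.pi * Complex.I * k)).exp_sub_one hr
  have e : ‖(2 * Real.pi * Complex.I * k : ℂ)‖ = 2 * Real.pi * |(k : ℝ)| := by
    simp [abs_of_pos Real.pi_pos, ← Complex.ofReal_intCast]
  rw [e] at this
  exact this

lemma fmode_comp (hr : 0 ≤ r) (h : WienerOn r ε g) (k : ℤ) :
    WienerOn r (fweight k ε) (fun z => fmode k (g z)) := by
  simpa using (h.fmode_sub_one hr k).add (const 1 r)

lemma abs_im_add_le (h : WienerOn r ε g) {z : ℂ} (hz : |z.im| ≤ r) :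
    |(z + g z).im| ≤ r + ε := by
  rw [Complex.add_im]
  exact (abs_add_le _ _).trans (add_le_add hz ((Complex.abs_im_le_norm _).trans (h.norm_le hz)))

lemma comp {w : ℂ → ℂ} (hρ : 0 ≤ ρ) (h : WienerOn r ε g) (hw : WienerOn ρ t w)
    (hr : ρ + t ≤ r) : WienerOn ρ ε (fun z => g (z + w z)) := by
  replace h := h.mono_left hr
  obtain ⟨ι, a, k, ⟨S, hSε, hS⟩, hg⟩ := h
  have hterm : ∀ i, WienerOn ρ (‖a i‖ * fweight (k i) (ρ + t))
      (fun z => a i * fmode (k i) z * fmode (k i) (w z)) := fun i => by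
    have := mul hρ (term (a i) (k i) ρ) (hw.fmode_comp hρ (k i))
    rwa [mul_assoc, ← fweight_add] at this
  have := tsum hterm hS.summable
  rw [hS.tsum_eq] at this
  refine (this.mono_right hSε).congr fun z hz => ?_
  rw [← (hg _ (hw.abs_im_add_le hz)).tsum_eq]
  exact tsum_congr fun i => by rw [fmode_add, mul_assoc]

lemma translate (h : WienerOn r ε g) (b : ℝ) : WienerOn r ε (fun z => g (z + b)) := by
  obtain ⟨ι, a, k, ⟨S, hSε, hS⟩, hg⟩ := h
  refine ⟨ι, fun i => a i * fmode (k i) b, k, ⟨S, hSε, ?_⟩, fun z hz => ?_⟩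
  · simpa only [norm_mul, norm_fmode_ofReal, mul_one] using hS
  · have := hg (z + b) (by simpa using hz)
    simpa only [fmode_add, mul_assoc, mul_comm (fmode _ (b : ℂ))] using this

lemma fweight_sub_one_le {k : ℤ} (hδ : 0 < δ) (ht : 0 ≤ t) (htδ : t ≤ δ) :
    fweight k t - 1 ≤ t / δ * fweight k δ := by
  have hc := convexOn_exp.2 (Set.mem_univ (2 * Real.pi * |(k : ℝ)| * δ)) (Set.mem_univ 0)
    (div_nonneg ht hδ.le) (sub_nonneg.2 ((div_le_one hδ).2 htδ)) (by ring)
  simp only [smul_eq_mul, mul_zero, add_zero, Real.exp_zero, mul_one] at hc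
  have e : t / δ * (2 * Real.pi * |(k : ℝ)| * δ) = 2 * Real.pi * |(k : ℝ)| * t := by
    field_simp
  rw [e] at hc
  have : 0 ≤ t / δ := div_nonneg ht hδ.le
  unfold fweight
  linarith

lemma comp_sub {w v : ℂ → ℂ} (hρ : 0 ≤ ρ) (h : WienerOn r ε g) (hw : WienerOn ρ s w)
    (hv : WienerOn ρ t v) (hδ : 0 < δ) (htδ : t ≤ δ) (hr : ρ + s + δ ≤ r) :
    WienerOn ρ (ε * (t / δ)) (fun z => g (z + (w z + v z)) - g (z + w z)) := by
  replace h := h.mono_left hr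
  have ht := hv.nonneg
  obtain ⟨ι, a, k, ⟨S, hSε, hS⟩, hg⟩ := h
  have hterm : ∀ i, WienerOn ρ (‖a i‖ * fweight (k i) (ρ + s + δ) * (t / δ))
      (fun z => a i * fmode (k i) z * fmode (k i) (w z) * (fmode (k i) (v z) - 1)) := fun i => by
    have := mul hρ (mul hρ (term (a i) (k i) ρ) (hw.fmode_comp hρ (k i)))
      (hv.fmode_sub_one hρ (k i))
    refine this.mono_right ?_
    calc _ ≤ ‖a i‖ * fweight (k i) ρ * fweight (k i) s * (t / δ * fweight (k i) δ) := by
          have := (fweight_pos (k i) ρ).le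
          have := (fweight_pos (k i) s).le
          gcongr
          exact fweight_sub_one_le hδ ht htδ
      _ = _ := by rw [fweight_add, fweight_add]; ring
  have hS' := hS.mul_right (t / δ)
  have := tsum hterm hS'.summable
  rw [hS'.tsum_eq] at this
  refine (this.mono_right (mul_le_mul_of_nonneg_right hSε (by positivity))).congr fun z hz => ?_
  have h1 := hg (z + (w z + v z)) (((hw.add hv).abs_im_add_le hz).trans (by linarith))
  have h2 := hg (z + w z) ((hw.abs_im_add_le hz).trans (by linarith))
  rw [← (h1.sub h2).tsum_eq]
  exact tsum_congr fun i => by rw [fmode_add, fmode_add, fmode_add]; ring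

/-- The reflection `z ↦ conj (g (conj z))`. -/
lemma star (h : WienerOn r ε g) :
    WienerOn r ε (fun z => (starRingEnd ℂ) (g ((starRingEnd ℂ) z))) := by
  obtain ⟨ι, a, k, ⟨S, hSε, hS⟩, hg⟩ := h
  refine ⟨ι, fun i => (starRingEnd ℂ) (a i), fun i => -k i, ⟨S, hSε, ?_⟩, fun z hz => ?_⟩
  · simpa [fweight] using hS
  · have := Complex.hasSum_conj'.2 (hg ((starRingEnd ℂ) z) (by simpa using hz))
    convert this using 2 with i
    rw [map_mul, fmode, fmode, ← Complex.exp_conj]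
    congr 2
    simp only [map_mul, Complex.conj_ofReal, Complex.conj_I, Complex.conj_conj, map_intCast,
      Complex.conj_ofNat]
    push_cast
    ring

lemma map_add_one (h : WienerOn r ε g) {z : ℂ} (hz : |z.im| ≤ r) : g (z + 1) = g z := by
  obtain ⟨ι, a, k, -, hg⟩ := h
  have h1 := hg (z + 1) (by simpa using hz)
  simp only [fmode_add, fmode_one, mul_one] at h1
  exact h1.unique (hg z hz)

lemma norm_fmode_sub_le (k : ℤ) {z w : ℂ} (hz : |z.im| ≤ r) (hw : |w.im| ≤ r) :
    ‖fmode k z - fmode k w‖ ≤ 2 * Real.pi * |(k : ℝ)| * fweight k r * ‖z - w‖ := by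
  have hd : ∀ x ∈ {z : ℂ | |z.im| ≤ r},
      HasDerivWithinAt (fmode k) (fmode k x * (2 * Real.pi * Complex.I * k))
        {z : ℂ | |z.im| ≤ r} x := fun x _ => by
    have := (((hasDerivAt_id x).const_mul (2 * Real.pi * Complex.I * k)).cexp).hasDerivWithinAt
      (s := {z : ℂ | |z.im| ≤ r})
    rw [mul_one] at this
    exact this
  have hconv : Convex ℝ {z : ℂ | |z.im| ≤ r} := by
    have : {z : ℂ | |z.im| ≤ r} = Complex.imLm ⁻¹' Set.Icc (-r) r := by
      ext z; simp [abs_le]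
    rw [this]
    exact (convex_Icc _ _).linear_preimage _
  refine hconv.norm_image_sub_le_of_norm_hasDerivWithin_le hd (fun x hx => ?_) hw hz
  have e : ‖(2 * Real.pi * Complex.I * k : ℂ)‖ = 2 * Real.pi * |(k : ℝ)| := by
    simp [abs_of_pos Real.pi_pos, ← Complex.ofReal_intCast]
  rw [norm_mul, e, mul_comm]
  exact mul_le_mul_of_nonneg_left (norm_fmode_le _ hx) (by positivity)

/-- Cauchy's estimate: `g` is Lipschitz on a thinner strip. -/
lemma norm_sub_le (h : WienerOn r ε g) (hρ : ρ < r) {z w : ℂ} (hz : |z.im| ≤ ρ)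
    (hw : |w.im| ≤ ρ) : ‖g z - g w‖ ≤ ε / (r - ρ) * ‖z - w‖ := by
  obtain ⟨ι, a, k, ⟨S, hSε, hS⟩, hg⟩ := h
  have hs := (hg z (hz.trans hρ.le)).sub (hg w (hw.trans hρ.le))
  have hpos : 0 < r - ρ := sub_pos.2 hρ
  have hS' := (hS.div_const (r - ρ)).mul_right ‖z - w‖
  refine le_trans ?_ (mul_le_mul_of_nonneg_right
    (div_le_div_of_nonneg_right hSε hpos.le) (norm_nonneg _))
  rw [← hs.tsum_eq]
  refine tsum_of_norm_bounded hS' fun i => ?_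
  rw [← mul_sub, norm_mul]
  have h1 := norm_fmode_sub_le (k i) hz hw
  have h2 : 2 * Real.pi * |(k i : ℝ)| * fweight (k i) ρ ≤ fweight (k i) r / (r - ρ) := by
    rw [le_div_iff₀ hpos]
    have e : fweight (k i) r = fweight (k i) ρ * fweight (k i) (r - ρ) := by
      rw [← fweight_add]; congr 1; ring
    have h3 : 2 * Real.pi * |(k i : ℝ)| * (r - ρ) ≤ fweight (k i) (r - ρ) := by
      unfold fweight
      linarith [Real.add_one_le_exp (2 * Real.pi * |(k i : ℝ)| * (r - ρ))]
    rw [e]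
    have := mul_le_mul_of_nonneg_left h3 (fweight_pos (k i) ρ).le
    linarith
  calc _ ≤ ‖a i‖ * (2 * Real.pi * |(k i : ℝ)| * fweight (k i) ρ * ‖z - w‖) := by gcongr
    _ ≤ ‖a i‖ * (fweight (k i) r / (r - ρ) * ‖z - w‖) := by gcongr
    _ = _ := by ring

lemma differentiableOn (h : WienerOn r ε g) : DifferentiableOn ℂ g {z : ℂ | |z.im| < r} := by
  obtain ⟨ι, a, k, ⟨S, hSε, hS⟩, hg⟩ := h
  have hopen : IsOpen {z : ℂ | |z.im| < r} :=
    isOpen_lt (Complex.continuous_im.abs) continuous_const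
  have := Complex.differentiableOn_tsum_of_summable_norm (F := fun i z => a i * fmode (k i) z)
    hS.summable (fun i => ?_) hopen (fun i w hw => ?_)
  · exact this.congr fun z hz => (hg z (le_of_lt hz)).tsum_eq.symm
  · unfold fmode
    fun_prop
  · rw [norm_mul]
    exact mul_le_mul_of_nonneg_left (norm_fmode_le _ (le_of_lt hw)) (norm_nonneg _)

end WienerOn
end Wiener

section Kam

namespace WienerOn

variable {r ρ ε s t δ Ω α : ℝ} {N : ℕ} {g ψ : ℂ → ℂ}

/-- Termwise modification of an expansion. -/
lemma of_le {ι : Type} {a b : ι → ℂ} {k : ι → ℤ} {S C r' : ℝ} (hC : 0 ≤ C) (hSε : S ≤ ε)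
    (hS : HasSum (fun i => ‖a i‖ * fweight (k i) r) S)
    (hb : ∀ i, ‖b i‖ * fweight (k i) r' ≤ C * (‖a i‖ * fweight (k i) r)) :
    WienerOn r' (C * ε) (fun z => ∑' i, b i * fmode (k i) z) ∧
      ∀ z : ℂ, |z.im| ≤ r' → Summable fun i => b i * fmode (k i) z := by
  have hs : Summable fun i => ‖b i‖ * fweight (k i) r' := Summable.of_nonneg_of_le
    (fun i => mul_nonneg (norm_nonneg _) (fweight_pos _ _).le) hb (hS.mul_left C).summable
  have hz : ∀ z : ℂ, |z.im| ≤ r' → Summable fun i => b i * fmode (k i) z := fun z hz => by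
    refine Summable.of_norm_bounded hs fun i => ?_
    rw [norm_mul]
    exact mul_le_mul_of_nonneg_left (norm_fmode_le _ hz) (norm_nonneg _)
  exact ⟨⟨ι, b, k, ⟨_, (hasSum_le hb hs.hasSum (hS.mul_left C)).trans (by gcongr), hs.hasSum⟩,
    fun z h => (hz z h).hasSum⟩, hz⟩

lemma exists_cohomological (hr : 0 ≤ r) (hδ : 0 ≤ δ) (hΩ0 : 0 ≤ Ω)
    (hΩ : ∀ k : ℤ, k ≠ 0 → |k| < N → 1 ≤ Ω * ‖fmode k α - 1‖) (h : WienerOn r ε g)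
    (hδr : δ ≤ r) :
    ∃ (c : ℂ) (ψ R : ℂ → ℂ), WienerOn r (Ω * ε) ψ ∧
      WienerOn (r - δ) (Real.exp (-(2 * Real.pi * N * δ)) * ε) R ∧
      ∀ x : ℝ, g x = c + (ψ x - ψ ((x + α : ℝ) : ℂ)) + R x := by
  classical
  obtain ⟨ι, a, k, ⟨S, hSε, hS⟩, hg⟩ := h
  set b : ι → ℂ := fun i => if k i ≠ 0 ∧ |k i| < N then a i / (1 - fmode (k i) α) else 0 with hb
  set d : ι → ℂ := fun i => if k i ≠ 0 ∧ (N : ℤ) ≤ |k i| then a i else 0 with hd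
  set e : ι → ℂ := fun i => if k i = 0 then a i else 0 with he
  have hbl : ∀ i, ‖b i‖ * fweight (k i) r ≤ Ω * (‖a i‖ * fweight (k i) r) := fun i => by
    rw [← mul_assoc]
    refine mul_le_mul_of_nonneg_right ?_ (fweight_pos _ _).le
    simp only [hb]
    split_ifs with hk
    · have h1 := hΩ (k i) hk.1 hk.2
      rw [norm_sub_rev] at h1
      have hpos : 0 < ‖1 - fmode (k i) α‖ := by
        rcases (norm_nonneg (1 - fmode (k i) α)).eq_or_lt with h0 | h0
        · rw [← h0] at h1; linarith
        · exact h0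
      rw [norm_div, div_le_iff₀ hpos]
      nlinarith [norm_nonneg (a i)]
    · rw [norm_zero]; positivity
  have hdl : ∀ i, ‖d i‖ * fweight (k i) (r - δ) ≤
      Real.exp (-(2 * Real.pi * N * δ)) * (‖a i‖ * fweight (k i) r) := fun i => by
    simp only [hd]
    split_ifs with hk
    · have h1 : fweight (k i) (r - δ) ≤ Real.exp (-(2 * Real.pi * N * δ)) * fweight (k i) r := by
        rw [fweight, fweight, ← Real.exp_add, Real.exp_le_exp]
        have h2 : (N : ℝ) ≤ |(k i : ℝ)| := by exact_mod_cast hk.2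
        have h3 := mul_le_mul_of_nonneg_right h2 hδ
        nlinarith [Real.pi_pos]
      calc _ ≤ ‖a i‖ * (Real.exp (-(2 * Real.pi * N * δ)) * fweight (k i) r) := by gcongr
        _ = _ := by ring
    · have := (fweight_pos (k i) r).le
      rw [norm_zero, zero_mul]; positivity
  have hel : ∀ i, ‖e i‖ * fweight (k i) r ≤ 1 * (‖a i‖ * fweight (k i) r) := fun i => by
    simp only [he]
    split_ifs with hk
    · rw [one_mul]
    · have := (fweight_pos (k i) r).le
      rw [norm_zero, zero_mul]; positivity
  obtain ⟨hψ, hψs⟩ := of_le hΩ0 hSε hS hbl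
  obtain ⟨hR, hRs⟩ := of_le (Real.exp_pos _).le hSε hS hdl
  obtain ⟨-, hes⟩ := of_le zero_le_one hSε hS hel
  have hes0 : Summable e := by
    have := hes 0 (by simpa using hr)
    simpa [fmode] using this
  refine ⟨∑' i, e i, _, _, hψ, hR, fun x => ?_⟩
  have hx : |(x : ℂ).im| ≤ r := by simpa using hr
  have hxα : |((x + α : ℝ) : ℂ).im| ≤ r := by simpa using hr
  have hx' : |(x : ℂ).im| ≤ r - δ := by simpa using hδr
  have hsum := (hes0.hasSum.add ((hψs x hx).hasSum.sub (hψs _ hxα).hasSum)).add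
    (hRs x hx').hasSum
  refine (hg x hx).unique ?_
  convert hsum using 2 with i
  simp only [hb, hd, he]
  push_cast
  rw [fmode_add]
  by_cases h0 : k i = 0
  · simp [h0, fmode_zero]
  · by_cases hN : |k i| < N
    · have hne : (1 - fmode (k i) α) ≠ 0 := by
        intro h1
        have h2 := hΩ (k i) h0 hN
        rw [norm_sub_rev, h1, norm_zero, mul_zero] at h2
        linarith
      simp only [h0, hN, not_le.2 hN, ne_eq, not_false_eq_true, and_self, and_false, if_true,
        if_false, zero_mul, zero_add, add_zero]
      field_simp
    · simp [h0, hN, not_lt.1 hN]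

lemma symmetrize (hr : 0 ≤ r) (h : WienerOn r ε g) :
    ∃ g' : ℂ → ℂ, WienerOn r ε g' ∧ ∀ x : ℝ, g' x = ((g x).re : ℂ) := by
  refine ⟨fun z => (1 / 2 : ℂ) * (g z + (starRingEnd ℂ) (g ((starRingEnd ℂ) z))), ?_, fun x => ?_⟩
  · refine ((h.add h.star).const_mul hr (1 / 2)).mono_right ?_
    norm_num
    linarith
  · simp only [Complex.conj_ofReal, Complex.add_conj]
    push_cast
    ring

lemma exists_cohomological_real (hr : 0 ≤ r) (hδ : 0 ≤ δ) (hΩ0 : 0 ≤ Ω)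
    (hΩ : ∀ k : ℤ, k ≠ 0 → |k| < N → 1 ≤ Ω * ‖fmode k α - 1‖) (h : WienerOn r ε g)
    (hg : ∀ x : ℝ, (g x).im = 0) (hδr : δ ≤ r) :
    ∃ (c : ℝ) (ψ R : ℂ → ℂ), WienerOn r (Ω * ε) ψ ∧ (∀ x : ℝ, (ψ x).im = 0) ∧
      WienerOn (r - δ) (Real.exp (-(2 * Real.pi * N * δ)) * ε) R ∧ (∀ x : ℝ, (R x).im = 0) ∧
      ∀ x : ℝ, g x = c + (ψ x - ψ ((x + α : ℝ) : ℂ)) + R x := by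
  obtain ⟨c, ψ, R, hψ, hR, he⟩ := exists_cohomological hr hδ hΩ0 hΩ h hδr
  obtain ⟨ψ', hψ', hψe⟩ := hψ.symmetrize hr
  obtain ⟨R', hR', hRe⟩ := hR.symmetrize (sub_nonneg.2 hδr)
  refine ⟨c.re, ψ', R', hψ', fun x => by simp [hψe], hR', fun x => by simp [hRe], fun x => ?_⟩
  rw [hψe, hψe, hRe]
  apply Complex.ext
  · simpa using congrArg Complex.re (he x)
  · simpa using hg x

/-- The fixed-point iteration solving `χ = -ψ ∘ (id + χ)`. -/
noncomputable def inverseIter (ψ : ℂ → ℂ) : ℕ → ℂ → ℂ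
  | 0 => fun _ => 0
  | n + 1 => fun z => -ψ (z + inverseIter ψ n z)

lemma inverseIter_wienerOn (hρ : 0 ≤ ρ) (hψ : WienerOn r s ψ) (hr : ρ + s ≤ r) (n : ℕ) :
    WienerOn ρ s (inverseIter ψ n) := by
  induction n with
  | zero => exact (const 0 ρ).mono_right (by simpa using hψ.nonneg)
  | succ n ih => exact (comp hρ hψ ih hr).neg hρ

lemma inverseIter_im (hψ : ∀ x : ℝ, (ψ x).im = 0) (n : ℕ) (x : ℝ) :
    (inverseIter ψ n x).im = 0 := by
  induction n generalizing x with
  | zero => simp [inverseIter]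
  | succ n ih =>
    have : (x : ℂ) + inverseIter ψ n x = ((x + (inverseIter ψ n x).re : ℝ) : ℂ) := by
      apply Complex.ext <;> simp [ih]
    change (-ψ (x + inverseIter ψ n x)).im = 0
    rw [this, Complex.neg_im, hψ, neg_zero]

lemma inverseIter_sub_wienerOn (hρ : 0 ≤ ρ) (hψ : WienerOn r s ψ) (hδ : 0 < δ) (hs : 4 * s ≤ δ)
    (hr : ρ + s + δ ≤ r) (n : ℕ) :
    WienerOn ρ (s * (1 / 4) ^ n) (fun z => inverseIter ψ (n + 1) z - inverseIter ψ n z) := by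
  have hs0 := hψ.nonneg
  induction n with
  | zero => simpa [inverseIter] using (hψ.mono_left (by linarith : ρ ≤ r)).neg hρ
  | succ n ih =>
    have hle : s * (1 / 4 : ℝ) ^ n ≤ s :=
      mul_le_of_le_one_right hs0 (pow_le_one₀ (by norm_num) (by norm_num))
    have := (comp_sub hρ hψ (inverseIter_wienerOn hρ hψ (by linarith) n) ih hδ (by linarith)
      hr).neg hρ
    refine (this.mono_right ?_).congr fun z _ => ?_
    · rw [pow_succ, mul_div_assoc', div_le_iff₀ hδ]
      have h0 : 0 ≤ s * (1 / 4 : ℝ) ^ n := by positivity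
      nlinarith
    · change _ = -ψ (z + inverseIter ψ (n + 1) z) - -ψ (z + inverseIter ψ n z)
      rw [add_sub_cancel]
      ring

lemma exists_inverse (hρ : 0 ≤ ρ) (hψ : WienerOn r s ψ) (hψr : ∀ x : ℝ, (ψ x).im = 0)
    (hδ : 0 < δ) (hs : 4 * s ≤ δ) (hr : ρ + s + δ ≤ r) :
    ∃ χ : ℂ → ℂ, WienerOn ρ (2 * s) χ ∧ (∀ x : ℝ, (χ x).im = 0) ∧
      ∀ z : ℂ, |z.im| ≤ ρ → χ z = -ψ (z + χ z) := by
  have hs0 := hψ.nonneg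
  have hgeo : HasSum (fun n : ℕ => s * (1 / 4 : ℝ) ^ n) (s * (1 - 1 / 4)⁻¹) :=
    (hasSum_geometric_of_lt_one (by norm_num) (by norm_num)).mul_left s
  have hW := tsum (inverseIter_sub_wienerOn hρ hψ hδ hs hr) hgeo.summable
  rw [hgeo.tsum_eq] at hW
  replace hW := hW.mono_right (show s * (1 - 1 / 4)⁻¹ ≤ 2 * s by norm_num; linarith)
  set χ : ℂ → ℂ := fun z => ∑' n, (inverseIter ψ (n + 1) z - inverseIter ψ n z) with hχ
  have hlim : ∀ z : ℂ, |z.im| ≤ ρ → Tendsto (fun n => inverseIter ψ n z) atTop (𝓝 (χ z)) := by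
    intro z hz
    have hsum : Summable fun n => inverseIter ψ (n + 1) z - inverseIter ψ n z :=
      Summable.of_norm_bounded hgeo.summable fun n =>
        (inverseIter_sub_wienerOn hρ hψ hδ hs hr n).norm_le hz
    have := hsum.hasSum.tendsto_sum_nat
    simpa only [Finset.sum_range_sub (fun n => inverseIter ψ n z),
      show inverseIter ψ 0 z = 0 from rfl, sub_zero] using this
  refine ⟨χ, hW, fun x => ?_, fun z hz => ?_⟩
  · have h1 := (Complex.continuous_im.tendsto _).comp (hlim x (by simpa using hρ))
    have h2 : Complex.im ∘ (fun n => inverseIter ψ n (x : ℂ)) = fun _ => 0 :=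
      funext fun n => inverseIter_im hψr n x
    rw [h2] at h1
    exact tendsto_nhds_unique h1 tendsto_const_nhds
  · have h1 := (hlim z hz).comp (tendsto_add_atTop_nat 1)
    refine tendsto_nhds_unique h1 ?_
    have hopen : IsOpen {z : ℂ | |z.im| < r} :=
      isOpen_lt (Complex.continuous_im.abs) continuous_const
    have hmem : z + χ z ∈ {z : ℂ | |z.im| < r} :=
      (hW.abs_im_add_le hz).trans_lt (by linarith)
    have hc := (hψ.differentiableOn.differentiableAt (hopen.mem_nhds hmem)).continuousAt.tendsto
    exact (hc.comp ((hlim z hz).const_add z)).neg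

lemma inverse_apply {χ : ℂ → ℂ} (hρ : 0 ≤ ρ) (hψ : WienerOn r s ψ)
    (hψr : ∀ x : ℝ, (ψ x).im = 0) (hsr : 2 * s ≤ r) (hr : 0 < r) (hχr : ∀ x : ℝ, (χ x).im = 0)
    (hχ : ∀ z : ℂ, |z.im| ≤ ρ → χ z = -ψ (z + χ z)) (x : ℝ) :
    (x + ψ x) + χ (x + ψ x) = x := by
  obtain ⟨y, hy⟩ : ∃ y : ℝ, (x : ℂ) + ψ x = y :=
    ⟨x + (ψ x).re, by apply Complex.ext <;> simp [hψr]⟩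
  rw [hy]
  obtain ⟨w, hw⟩ : ∃ w : ℝ, (y : ℂ) + χ y = w :=
    ⟨y + (χ y).re, by apply Complex.ext <;> simp [hχr]⟩
  have h1 := hχ y (by simpa using hρ)
  rw [hw] at h1 ⊢
  have h2 := hψ.norm_sub_le hr (z := x) (w := w) (by simp) (by simp)
  have h3 : ψ x - ψ w = w - x := by linear_combination hy + hw - h1
  rw [h3, norm_sub_rev, sub_zero] at h2
  have h4 : s / r ≤ 1 / 2 := by rw [div_le_iff₀ hr]; linarith
  have h5 : ‖(x : ℂ) - w‖ = 0 := by
    nlinarith [norm_nonneg ((x : ℂ) - w)]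
  exact (sub_eq_zero.1 (norm_eq_zero.1 h5)).symm

end WienerOn

/-- `id + Ψ` conjugates `F` on the real line to a real perturbation of size `ε`, analytic on the
strip of width `r`, of the translation by `α`. -/
def AlmostConj (F : ℝ → ℝ) (α : ℝ) (Ψ : ℂ → ℂ) (r ε : ℝ) : Prop :=
  ∃ (c : ℝ) (g : ℂ → ℂ), WienerOn r ε g ∧ (∀ x : ℝ, (g x).im = 0) ∧ |c| ≤ ε ∧
    ∀ x : ℝ, (F x : ℂ) + Ψ (F x) = x + Ψ x + (α + c + g (x + Ψ x))

variable {F : ℝ → ℝ} {α r ε t x Ω : ℝ} {N : ℕ} {Ψ g : ℂ → ℂ}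

lemma le_of_isRotNumber {h : ℝ → ℝ} {β : ℝ} (hrot : IsRotNumber F α)
    (hh : ∀ x, |h x - x| ≤ t) (hF : ∀ x, h x + β ≤ h (F x)) : β ≤ α := by
  have hn : ∀ n : ℕ, h 0 + n * β ≤ h (F^[n] 0) := fun n => by
    induction n with
    | zero => simp
    | succ n ih =>
      rw [Function.iterate_succ_apply']
      have := hF (F^[n] 0)
      push_cast
      linarith
  have h1 : Tendsto (fun n : ℕ => β - 2 * t / n) atTop (𝓝 (β - 0)) :=
    tendsto_const_nhds.sub (tendsto_const_div_atTop_nhds_zero_nat _)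
  rw [sub_zero] at h1
  refine le_of_tendsto_of_tendsto h1 (hrot 0) ?_
  filter_upwards [eventually_gt_atTop 0] with n hn0
  have hn0' : (0 : ℝ) < n := by exact_mod_cast hn0
  rw [le_div_iff₀ hn0', sub_mul, div_mul_cancel₀ _ hn0'.ne']
  have := abs_le.1 (hh 0)
  have := abs_le.1 (hh (F^[n] 0))
  have := hn n
  linarith

lemma ge_of_isRotNumber {h : ℝ → ℝ} {β : ℝ} (hrot : IsRotNumber F α)
    (hh : ∀ x, |h x - x| ≤ t) (hF : ∀ x, h (F x) ≤ h x + β) : α ≤ β := by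
  have hn : ∀ n : ℕ, h (F^[n] 0) ≤ h 0 + n * β := fun n => by
    induction n with
    | zero => simp
    | succ n ih =>
      rw [Function.iterate_succ_apply']
      have := hF (F^[n] 0)
      push_cast
      linarith
  have h1 : Tendsto (fun n : ℕ => β + 2 * t / n) atTop (𝓝 (β + 0)) :=
    tendsto_const_nhds.add (tendsto_const_div_atTop_nhds_zero_nat _)
  rw [add_zero] at h1
  refine le_of_tendsto_of_tendsto (hrot 0) h1 ?_
  filter_upwards [eventually_gt_atTop 0] with n hn0
  have hn0' : (0 : ℝ) < n := by exact_mod_cast hn0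
  rw [div_le_iff₀ hn0', add_mul, div_mul_cancel₀ _ hn0'.ne']
  have := abs_le.1 (hh 0)
  have := abs_le.1 (hh (F^[n] 0))
  have := hn n
  linarith

lemma abs_le_of_conj {c : ℝ} (hrot : IsRotNumber F α) (hΨ : WienerOn 2 t Ψ)
    (hΨr : ∀ x : ℝ, (Ψ x).im = 0) (hr : 0 ≤ r) (hg : WienerOn r ε g)
    (hconj : ∀ x : ℝ, (F x : ℂ) + Ψ (F x) = x + Ψ x + (α + c + g (x + Ψ x))) : |c| ≤ ε := by
  have hh : ∀ x : ℝ, |x + (Ψ x).re - x| ≤ t := fun x => by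
    rw [add_sub_cancel_left]
    exact (Complex.abs_re_le_norm _).trans (hΨ.norm_le (by simp))
  have hre : ∀ x : ℝ, F x + (Ψ (F x)).re = x + (Ψ x).re + (α + c + (g (x + Ψ x)).re) := fun x => by
    simpa using congrArg Complex.re (hconj x)
  have hb : ∀ x : ℝ, |(g (x + Ψ x)).re| ≤ ε := fun x =>
    (Complex.abs_re_le_norm _).trans (hg.norm_le (by simpa [hΨr] using hr))
  have h1 := le_of_isRotNumber (h := fun x => x + (Ψ x).re) (β := α + c - ε) hrot hh fun x => by
    have := abs_le.1 (hb x)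
    have := hre x
    linarith
  have h2 := ge_of_isRotNumber (h := fun x => x + (Ψ x).re) (β := α + c + ε) hrot hh fun x => by
    have := abs_le.1 (hb x)
    have := hre x
    linarith
  rw [abs_le]
  constructor <;> linarith

lemma AlmostConj.mono {r' ε' : ℝ} (h : AlmostConj F α Ψ r ε) (hr : r' ≤ r) (hε : ε ≤ ε') :
    AlmostConj F α Ψ r' ε' := by
  obtain ⟨c, g, hg, hgr, hc, h⟩ := h
  exact ⟨c, g, (hg.mono_left hr).mono_right hε, hgr, hc.trans hε, h⟩

/-- One Newton step, with free parameters. -/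
lemma AlmostConj.newton {δ δ' : ℝ} (hrot : IsRotNumber F α) (hΨ : WienerOn 2 t Ψ)
    (hΨr : ∀ x : ℝ, (Ψ x).im = 0) (h : AlmostConj F α Ψ r ε) (hΩ0 : 0 ≤ Ω)
    (hΩ : ∀ k : ℤ, k ≠ 0 → |k| < N → 1 ≤ Ω * ‖fmode k α - 1‖) (hδ : 0 ≤ δ) (hδ' : 0 < δ')
    (hs : 4 * (Ω * ε) ≤ δ') (hε : 2 * ε ≤ δ') (hr : 0 ≤ r - δ - 2 * δ') (ht : 2 + t ≤ r) :
    ∃ Δ : ℂ → ℂ, WienerOn 2 (Ω * ε) Δ ∧ (∀ x : ℝ, (Δ x).im = 0) ∧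
      AlmostConj F α (fun z => Ψ z + Δ z) (r - δ - 2 * δ')
        (Real.exp (-(2 * Real.pi * N * δ)) * ε + Ω * ε * (2 * ε / δ')) := by
  obtain ⟨c, g, hg, hgr, hc, hconj⟩ := h
  obtain ⟨c₁, ψ, R, hψ, hψr, hR, hRr, he⟩ := hg.exists_cohomological_real (N := N) (δ := δ)
    (by linarith) hδ hΩ0 hΩ hgr (by linarith)
  have hs0 := hψ.nonneg
  obtain ⟨χ, hχ, hχr, hχe⟩ := WienerOn.exists_inverse (ρ := r - δ - 2 * δ') hr hψ hψr hδ' hs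
    (by linarith)
  set u : ℂ → ℂ := fun z => ψ (z + (0 + (c + g z)) + α) - ψ (z + 0 + α) with hu
  have huW : WienerOn (r - δ') (Ω * ε * (2 * ε / δ')) u := by
    have h0 : WienerOn (r - δ') 0 (fun _ => 0) := by simpa using WienerOn.const 0 (r - δ')
    have hv : WienerOn (r - δ') (2 * ε) (fun z => c + g z) := by
      refine ((WienerOn.const (c : ℂ) (r - δ')).add (hg.mono_left (by linarith))).mono_right ?_
      rw [Complex.norm_real, Real.norm_eq_abs]
      linarith
    exact WienerOn.comp_sub (by linarith) (hψ.translate α) h0 hv hδ' hε (by linarith)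
  have hψ_real : ∀ z : ℂ, z.im = 0 → (ψ z).im = 0 := fun z hz => by
    have : z = (z.re : ℂ) := by apply Complex.ext <;> simp [hz]
    rw [this]; exact hψr _
  have hg_real : ∀ z : ℂ, z.im = 0 → (g z).im = 0 := fun z hz => by
    have : z = (z.re : ℂ) := by apply Complex.ext <;> simp [hz]
    rw [this]; exact hgr _
  have hur : ∀ z : ℂ, z.im = 0 → (u z).im = 0 := fun z hz => by
    simp only [hu, Complex.sub_im]
    rw [hψ_real _ (by simp [hz, hg_real z hz]), hψ_real _ (by simp [hz]), sub_zero]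
  have hRr' : ∀ z : ℂ, z.im = 0 → (R z).im = 0 := fun z hz => by
    have : z = (z.re : ℂ) := by apply Complex.ext <;> simp [hz]
    rw [this]; exact hRr _
  have hW : WienerOn (r - δ - 2 * δ')
      (Real.exp (-(2 * Real.pi * N * δ)) * ε + Ω * ε * (2 * ε / δ'))
      (fun z => R (z + χ z) + u (z + χ z)) :=
    (WienerOn.comp hr hR hχ (by linarith)).add (WienerOn.comp hr huW hχ (by linarith))
  have hΔ : WienerOn 2 (Ω * ε) (fun z => ψ (z + Ψ z)) :=
    WienerOn.comp (by norm_num) hψ hΨ ht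
  have hΔr : ∀ x : ℝ, (ψ (x + Ψ x)).im = 0 := fun x => hψ_real _ (by simp [hΨr])
  have hconj' : ∀ x : ℝ, (F x : ℂ) + (Ψ (F x) + ψ (F x + Ψ (F x))) =
      x + (Ψ x + ψ (x + Ψ x)) + (α + (c + c₁ : ℝ) +
        (R (x + (Ψ x + ψ (x + Ψ x)) + χ (x + (Ψ x + ψ (x + Ψ x)))) +
          u (x + (Ψ x + ψ (x + Ψ x)) + χ (x + (Ψ x + ψ (x + Ψ x)))))) := by
    intro x
    obtain ⟨y, hy⟩ : ∃ y : ℝ, (x : ℂ) + Ψ x = y :=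
      ⟨x + (Ψ x).re, by apply Complex.ext <;> simp [hΨr]⟩
    have h1 := WienerOn.inverse_apply hr hψ hψr (by linarith) (by linarith) hχr hχe y
    have h2 := hconj x
    have h3 := he y
    rw [← add_assoc, ← add_assoc (x : ℂ), h2, hy, h1]
    have h4 : u y = ψ (y + (α + c + g y)) - ψ ((y + α : ℝ) : ℂ) := by
      simp only [hu]
      push_cast
      ring_nf
    rw [h4]
    push_cast at h3 ⊢
    linear_combination h3
  refine ⟨_, hΔ, hΔr, c + c₁, _, hW, fun x => ?_, ?_, hconj'⟩
  · rw [Complex.add_im, hRr' _ (by simp [hχr]), hur _ (by simp [hχr]), add_zero]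
  · exact abs_le_of_conj hrot (hΨ.add hΔ) (fun x => by rw [Complex.add_im, hΨr, hΔr, add_zero])
      hr hW hconj'

/-- A Newton step halving the error. -/
lemma AlmostConj.halve (hrot : IsRotNumber F α) (hΨ : WienerOn 2 t Ψ)
    (hΨr : ∀ x : ℝ, (Ψ x).im = 0) (h : AlmostConj F α Ψ r ε) (hN : 1 ≤ N) (hΩ1 : 1 ≤ Ω)
    (hΩ : ∀ k : ℤ, k ≠ 0 → |k| < N → 1 ≤ Ω * ‖fmode k α - 1‖) (hx : 0 < x) (hx1 : x ≤ 1)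
    (hxε : Ω * ε = x ^ 2) (hr : 2 + Real.log 2 / (2 * Real.pi * N) + 17 * x ≤ r)
    (ht : 2 + t ≤ r) :
    ∃ Δ : ℂ → ℂ, WienerOn 2 (x ^ 2) Δ ∧ (∀ x : ℝ, (Δ x).im = 0) ∧
      AlmostConj F α (fun z => Ψ z + Δ z) (r - Real.log 2 / (2 * Real.pi * N) - 17 * x)
        (ε / 2) := by
  have hN' : (1 : ℝ) ≤ N := by exact_mod_cast hN
  have hpi := Real.pi_gt_three
  have hlog := Real.log_pos (one_lt_two : (1 : ℝ) < 2)
  have hε0 : 0 ≤ ε := by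
    obtain ⟨c, g, hg, -⟩ := h
    exact hg.nonneg
  set δ := (Real.log 2 + x) / (2 * Real.pi * N) with hδ
  have hD : 0 < 2 * Real.pi * (N : ℝ) := by positivity
  have hδle : δ ≤ Real.log 2 / (2 * Real.pi * N) + x := by
    rw [hδ, add_div]
    gcongr
    exact div_le_self hx.le (by nlinarith)
  have hεx : ε ≤ x ^ 2 := by nlinarith
  obtain ⟨Δ, hΔ, hΔr, hA⟩ := h.newton (δ := δ) (δ' := 8 * x) hrot hΨ hΨr (by linarith) hΩ
    (by positivity) (by positivity) (by nlinarith) (by nlinarith) (by linarith) ht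
  rw [hxε] at hΔ
  refine ⟨Δ, hΔ, hΔr, hA.mono (by linarith) ?_⟩
  have e1 : 2 * Real.pi * N * δ = Real.log 2 + x := by rw [hδ]; field_simp
  have e2 : Real.exp (-(2 * Real.pi * N * δ)) ≤ 1 / (2 * (1 + x)) := by
    rw [e1, Real.exp_neg, Real.exp_add, Real.exp_log two_pos, ← one_div]
    gcongr
    linarith [Real.add_one_le_exp x]
  have e3 : Ω * ε * (2 * ε / (8 * x)) = ε * (x / 4) := by
    rw [hxε]; field_simp; ring
  rw [e3]
  have e4 : 1 / (2 * (1 + x)) ≤ 1 / 2 - x / 4 := by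
    rw [div_le_iff₀ (by positivity)]
    nlinarith
  nlinarith

end Kam

section Stages

variable {F : ℝ → ℝ} {α r ε t x Ω : ℝ} {N : ℕ} {Ψ : ℂ → ℂ}

/-- Dividing the error by `2 ^ J` at a fixed frequency cut-off. -/
lemma AlmostConj.iterate_halve (hrot : IsRotNumber F α) (hΨ : WienerOn 2 t Ψ)
    (hΨr : ∀ x : ℝ, (Ψ x).im = 0) (h : AlmostConj F α Ψ r ε) (hN : 1 ≤ N) (hΩ1 : 1 ≤ Ω)
    (hΩ : ∀ k : ℤ, k ≠ 0 → |k| < N → 1 ≤ Ω * ‖fmode k α - 1‖) (hx : 0 < x) (hx1 : x ≤ 1)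
    (hxε : Ω * ε = x ^ 2) (ht : t + 2 * x ^ 2 ≤ 1) (J : ℕ)
    (hr : 3 + J * (Real.log 2 / (2 * Real.pi * N)) + 60 * x ≤ r) :
    ∃ Δ : ℂ → ℂ, WienerOn 2 (2 * x ^ 2) Δ ∧ (∀ x : ℝ, (Δ x).im = 0) ∧
      AlmostConj F α (fun z => Ψ z + Δ z)
        (r - J * (Real.log 2 / (2 * Real.pi * N)) - 60 * x) (ε / 2 ^ J) := by
  set q : ℝ := √(1 / 2) with hq
  have hq2 : q ^ 2 = 1 / 2 := Real.sq_sqrt (by norm_num)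
  have hq0 : 0 < q := Real.sqrt_pos.2 (by norm_num)
  have hq1 : q ≤ 43 / 60 := by nlinarith
  have hL : 0 ≤ Real.log 2 / (2 * Real.pi * N) := by
    have := Real.log_pos (one_lt_two : (1 : ℝ) < 2)
    have := Real.pi_pos
    positivity
  set L := Real.log 2 / (2 * Real.pi * N) with hLdef
  have key : ∀ J : ℕ, 3 + J * L + 60 * x ≤ r → ∃ Δ : ℂ → ℂ,
      WienerOn 2 (2 * (x ^ 2 - (x * q ^ J) ^ 2)) Δ ∧ (∀ x : ℝ, (Δ x).im = 0) ∧
      AlmostConj F α (fun z => Ψ z + Δ z) (r - J * L - 60 * (x - x * q ^ J)) (ε / 2 ^ J) := by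
    intro J
    induction J with
    | zero =>
      intro _
      refine ⟨fun _ => 0, by simpa using WienerOn.const 0 2, fun x => by simp, ?_⟩
      simpa using h
    | succ J ih =>
      intro hJ
      push_cast at hJ
      have hqJ0 : 0 < q ^ J := pow_pos hq0 J
      have hqJ1 : q ^ J ≤ 1 := pow_le_one₀ hq0.le (by linarith)
      have hxq : x * q ^ J ≤ x := mul_le_of_le_one_right hx.le hqJ1
      have hxq0 : 0 < x * q ^ J := by positivity
      obtain ⟨Δ, hΔ, hΔr, hA⟩ := ih (by linarith)
      have hsq : (x * q ^ J) ^ 2 = x ^ 2 / 2 ^ J := by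
        rw [mul_pow, ← pow_mul, mul_comm J 2, pow_mul, hq2]
        simp [div_eq_mul_inv]
      obtain ⟨Δ', hΔ', hΔr', hA'⟩ := hA.halve (x := x * q ^ J) hrot (hΨ.add hΔ)
        (fun x => by rw [Complex.add_im, hΨr, hΔr, add_zero]) hN hΩ1 hΩ hxq0 (by linarith)
        (by rw [hsq, ← hxε, mul_div_assoc]) (by rw [← hLdef]; linarith)
        (by nlinarith [sq_nonneg (x * q ^ J), mul_nonneg (Nat.cast_nonneg (α := ℝ) J) hL])
      refine ⟨fun z => Δ z + Δ' z, (hΔ.add hΔ').mono_right ?_,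
        fun x => by rw [Complex.add_im, hΔr, hΔr', add_zero], ?_⟩
      · rw [pow_succ q, ← mul_assoc, mul_pow (x * q ^ J), hq2]
        linarith
      · simp only [← add_assoc]
        refine hA'.mono ?_ ?_
        · rw [← hLdef, pow_succ, ← mul_assoc]
          push_cast
          nlinarith
        · rw [pow_succ, div_div]
  obtain ⟨Δ, hΔ, hΔr, hA⟩ := key J hr
  have : 0 < x * q ^ J := by positivity
  exact ⟨Δ, hΔ.mono_right (by nlinarith), hΔr, hA.mono (by linarith) le_rfl⟩

/-- The error allowed at the beginning of the `m`-th stage. -/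
noncomputable def stageError (α : ℝ) (m : ℕ) : ℝ := (1 / 4) ^ m / (16 * qden α m)

lemma smallDivisor_fmode (hα : Irrational α) (m : ℕ) (k : ℤ) (hk : k ≠ 0)
    (hkm : |k| < qden α m) : 1 ≤ (qden α m : ℝ) * ‖fmode k α - 1‖ :=
  smallDivisor_le hα m hk hkm

/-- One stage: passing from the denominator `q_m` to `q_{m+1}`. -/
lemma AlmostConj.stage (hα : Irrational α) (hrot : IsRotNumber F α) (m : ℕ)
    (hΨ : WienerOn 2 t Ψ) (hΨr : ∀ x : ℝ, (Ψ x).im = 0)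
    (h : AlmostConj F α Ψ r (stageError α m)) (ht : t ≤ 1 / 6)
    (hr : 3 + (Real.log (qden α (m + 1)) + Real.log 8) / qden α m / (2 * Real.pi) +
      15 * (1 / 2) ^ m ≤ r) :
    ∃ Δ : ℂ → ℂ, WienerOn 2 ((1 / 4) ^ m / 8) Δ ∧ (∀ x : ℝ, (Δ x).im = 0) ∧
      AlmostConj F α (fun z => Ψ z + Δ z)
        (r - (Real.log (qden α (m + 1)) + Real.log 8) / qden α m / (2 * Real.pi) -
          15 * (1 / 2) ^ m) (stageError α (m + 1)) := by
  have hq : (1 : ℝ) ≤ qden α m := by exact_mod_cast qden_pos hα m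
  have hq' : 1 ≤ qden α (m + 1) := qden_pos hα (m + 1)
  have hq'R : (1 : ℝ) ≤ qden α (m + 1) := by exact_mod_cast hq'
  have hpi := Real.pi_pos
  have hp : (1 / 2 : ℝ) ^ m ≤ 1 := pow_le_one₀ (by norm_num) (by norm_num)
  have hp0 : 0 < (1 / 2 : ℝ) ^ m := by positivity
  have hsq : ((1 / 2 : ℝ) ^ m / 4) ^ 2 = (1 / 4) ^ m / 16 := by
    rw [div_pow, ← pow_mul, mul_comm m 2, pow_mul]; norm_num
  have h4 : (1 / 4 : ℝ) ^ m ≤ 1 := pow_le_one₀ (by norm_num) (by norm_num)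
  have hxε : (qden α m : ℝ) * stageError α m = ((1 / 2 : ℝ) ^ m / 4) ^ 2 := by
    rw [hsq, stageError]; field_simp
  set J := Nat.clog 2 (4 * qden α (m + 1)) with hJ
  have hJ1 : (4 * qden α (m + 1) : ℝ) ≤ 2 ^ J := by
    exact_mod_cast Nat.le_pow_clog one_lt_two (4 * qden α (m + 1))
  have hJ2 : (2 : ℝ) ^ J ≤ 8 * qden α (m + 1) := by
    have h1 : 0 < J := Nat.clog_pos one_lt_two (by omega)
    have h2 := Nat.pow_pred_clog_lt_self one_lt_two (x := 4 * qden α (m + 1)) (by omega)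
    rw [← hJ] at h2
    have h3 : 2 ^ J = 2 * 2 ^ J.pred := by
      rw [← pow_succ', ← Nat.succ_eq_add_one, Nat.succ_pred_eq_of_pos h1]
    have h4 : 2 ^ J ≤ 8 * qden α (m + 1) := by omega
    exact_mod_cast h4
  have hJlog : J * Real.log 2 ≤ Real.log (qden α (m + 1)) + Real.log 8 := by
    rw [← Real.log_pow, ← Real.log_mul (by positivity) (by norm_num), mul_comm]
    exact Real.log_le_log (by positivity) hJ2
  have hloss : J * (Real.log 2 / (2 * Real.pi * qden α m)) ≤
      (Real.log (qden α (m + 1)) + Real.log 8) / qden α m / (2 * Real.pi) := by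
    rw [← mul_div_assoc, div_div, mul_comm (qden α m : ℝ)]
    gcongr
  obtain ⟨Δ, hΔ, hΔr, hA⟩ := h.iterate_halve (N := qden α m) (x := (1 / 2) ^ m / 4) hrot hΨ hΨr
    (qden_pos hα m) hq (smallDivisor_fmode hα m) (by positivity) (by linarith) hxε
    (by rw [hsq]; linarith) J (by linarith)
  refine ⟨Δ, hΔ.mono_right (by rw [hsq]; linarith), hΔr, hA.mono (by linarith) ?_⟩
  rw [stageError, stageError, pow_succ, div_div, div_le_div_iff₀ (by positivity) (by positivity)]
  have : (4 * qden α (m + 1) : ℝ) ≤ qden α m * 2 ^ J := by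
    nlinarith [pow_pos (two_pos : (0 : ℝ) < 2) J]
  have h5 : 0 < (1 / 4 : ℝ) ^ m := by positivity
  nlinarith

/-- The strip width left after `m` stages. -/
noncomputable def stageWidth (α r : ℝ) (m : ℕ) : ℝ :=
  r - (∑ n ∈ Finset.range m, (Real.log (qden α (n + 1)) + Real.log 8) / qden α n) / (2 * Real.pi) -
    30 * (1 - (1 / 2) ^ m)

lemma stageWidth_succ (α r : ℝ) (m : ℕ) : stageWidth α r (m + 1) = stageWidth α r m -
    (Real.log (qden α (m + 1)) + Real.log 8) / qden α m / (2 * Real.pi) - 15 * (1 / 2) ^ m := by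
  rw [stageWidth, stageWidth, Finset.sum_range_succ, pow_succ]
  ring

lemma exists_linearization (hα : Irrational α) (hrot : IsRotNumber F α)
    (h : AlmostConj F α (fun _ => 0) r (1 / 16)) (hr : ∀ m, 3 ≤ stageWidth α r m) :
    ∃ Ψ : ℂ → ℂ, WienerOn 2 (1 / 6) Ψ ∧ (∀ x : ℝ, (Ψ x).im = 0) ∧
      ∀ x : ℝ, (F x : ℂ) + Ψ (F x) = x + Ψ x + α := by
  set P : ℕ → (ℂ → ℂ) → Prop := fun m Ψ => WienerOn 2 ((1 - (1 / 4) ^ m) / 6) Ψ ∧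
    (∀ x : ℝ, (Ψ x).im = 0) ∧ AlmostConj F α Ψ (stageWidth α r m) (stageError α m) with hP
  have hP0 : P 0 (fun _ => 0) := by
    refine ⟨by simpa using WienerOn.const 0 2, fun x => by simp, ?_⟩
    simpa [stageWidth, stageError, qden] using h
  have hstep : ∀ m (Ψ : {Ψ // P m Ψ}), ∃ Δ : ℂ → ℂ, WienerOn 2 ((1 / 4) ^ m / 8) Δ ∧
      (∀ x : ℝ, (Δ x).im = 0) ∧ P (m + 1) (fun z => Ψ.1 z + Δ z) := by
    rintro m ⟨Ψ, hΨ, hΨr, hA⟩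
    have h4 : 0 < (1 / 4 : ℝ) ^ m := by positivity
    obtain ⟨Δ, hΔ, hΔr, hA'⟩ := hA.stage hα hrot m hΨ hΨr (by linarith)
      (by have := hr (m + 1); rw [stageWidth_succ] at this; linarith)
    refine ⟨Δ, hΔ, hΔr, (hΨ.add hΔ).mono_right ?_,
      fun x => by rw [Complex.add_im, hΨr, hΔr, add_zero], ?_⟩
    · rw [pow_succ]; linarith
    · rwa [stageWidth_succ]
  choose D hD hDr hDP using hstep
  let Φ : ∀ m, {Ψ // P m Ψ} := fun m =>
    Nat.rec ⟨fun _ => 0, hP0⟩ (fun m Ψ => ⟨fun z => Ψ.1 z + D m Ψ z, hDP m Ψ⟩) m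
  have hΦ0 : ∀ z, (Φ 0).1 z = 0 := fun _ => rfl
  have hΦs : ∀ m z, (Φ (m + 1)).1 z = (Φ m).1 z + D m (Φ m) z := fun _ _ => rfl
  have hgeo : HasSum (fun m : ℕ => (1 / 4 : ℝ) ^ m / 8) ((1 - 1 / 4)⁻¹ / 8) :=
    (hasSum_geometric_of_lt_one (by norm_num) (by norm_num)).div_const 8
  have hW := WienerOn.tsum (fun m => hD m (Φ m)) hgeo.summable
  rw [hgeo.tsum_eq] at hW
  have hlim : ∀ x : ℝ, Tendsto (fun m => (Φ m).1 x) atTop (𝓝 (∑' m, D m (Φ m) x)) := by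
    intro x
    have hsum : Summable fun m => D m (Φ m) (x : ℂ) :=
      Summable.of_norm_bounded hgeo.summable fun m => (hD m (Φ m)).norm_le (by simp)
    have hΦsum : ∀ m, (Φ m).1 (x : ℂ) = ∑ j ∈ Finset.range m, D j (Φ j) x := fun m => by
      induction m with
      | zero => exact hΦ0 _
      | succ m ih => rw [hΦs, Finset.sum_range_succ, ih]
    simpa only [hΦsum] using hsum.hasSum.tendsto_sum_nat
  refine ⟨_, hW.mono_right (by norm_num), fun x => ?_, fun x => ?_⟩
  · have h1 := (Complex.continuous_im.tendsto _).comp (hlim x)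
    have h2 : Complex.im ∘ (fun m => (Φ m).1 (x : ℂ)) = fun _ => 0 :=
      funext fun m => (Φ m).2.2.1 x
    rw [h2] at h1
    exact tendsto_nhds_unique h1 tendsto_const_nhds
  · have hl := ((hlim (F x)).const_add (F x : ℂ)).sub (((hlim x).const_add (x : ℂ)).add_const (α : ℂ))
    refine sub_eq_zero.1 (tendsto_nhds_unique hl ?_)
    have h0 : Tendsto (fun m : ℕ => 2 * (1 / 4 : ℝ) ^ m) atTop (𝓝 (2 * 0)) :=
      (tendsto_pow_atTop_nhds_zero_of_lt_one (by norm_num) (by norm_num)).const_mul 2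
    rw [mul_zero] at h0
    refine squeeze_zero_norm (fun m => ?_) h0
    obtain ⟨-, hr0, c, g, hg, -, hc, hconj⟩ := (Φ m).2
    have hε : stageError α m ≤ (1 / 4) ^ m := by
      refine div_le_self (by positivity) ?_
      have : (1 : ℝ) ≤ qden α m := by exact_mod_cast qden_pos hα m
      linarith
    have hw := hr m
    have h1 := hg.norm_le (z := x + (Φ m).1 x) (by simp [hr0]; linarith)
    rw [hconj x]
    calc _ = ‖(c : ℂ) + g (x + (Φ m).1 x)‖ := by ring_nf
      _ ≤ |c| + stageError α m := by
        refine (norm_add_le _ _).trans (add_le_add ?_ h1)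
        rw [Complex.norm_real, Real.norm_eq_abs]
      _ ≤ _ := by linarith

end Stages

section Limit

/-- A small perturbation of the identity is an analytic circle diffeomorphism. -/
lemma WienerOn.exists_diffeo {Ψ : ℂ → ℂ} (hΨ : WienerOn 2 (1 / 6) Ψ)
    (hΨr : ∀ x : ℝ, (Ψ x).im = 0) :
    ∃ h : AnalyticCircleDiffeo 1, ∀ x : ℝ, h.toFun x = x + Ψ x := by
  have hlip : ∀ z w : ℂ, |z.im| ≤ 1 → |w.im| ≤ 1 → ‖Ψ z - Ψ w‖ ≤ 1 / 6 * ‖z - w‖ :=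
    fun z w hz hw => by
      have h := hΨ.norm_sub_le one_lt_two hz hw
      rwa [show (2 : ℝ) - 1 = 1 by norm_num, div_one] at h
  refine ⟨{
    toFun := fun z => if |z.im| ≤ 1 then z + Ψ z else z
    diffOn := by
      have h : DifferentiableOn ℂ (fun z => z + Ψ z) {z : ℂ | |z.im| ≤ 1} :=
        differentiableOn_id.add (hΨ.differentiableOn.mono fun z (hz : |z.im| ≤ 1) =>
          show |z.im| < 2 by linarith)
      exact h.congr fun z hz => if_pos hz
    injOn := fun z (hz : |z.im| ≤ 1) w (hw : |w.im| ≤ 1) hzw => by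
      simp only [if_pos hz, if_pos hw] at hzw
      have h1 := hlip z w hz hw
      rw [show Ψ z - Ψ w = w - z by linear_combination hzw, norm_sub_rev] at h1
      have h2 : ‖z - w‖ = 0 := by nlinarith [norm_nonneg (z - w)]
      exact sub_eq_zero.1 (norm_eq_zero.1 h2)
    real_toFun := fun x => by simp [hΨr]
    map_add_one := fun z => by
      by_cases hz : |z.im| ≤ 1
      · have h1 : |(z + 1).im| ≤ 1 := by simpa using hz
        simp only [if_pos hz, if_pos h1, hΨ.map_add_one (hz.trans one_le_two)]
        ring
      · have h1 : ¬ |(z + 1).im| ≤ 1 := by simpa using hz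
        simp only [if_neg hz, if_neg h1]
    strictMono_real := fun x y hxy => by
      have h1 := hlip x y (by simp) (by simp)
      rw [← Complex.ofReal_sub, Complex.norm_real, Real.norm_eq_abs, abs_of_neg (by linarith)] at h1
      have h2 := (abs_le.1 ((Complex.abs_re_le_norm _).trans h1)).2
      rw [Complex.sub_re] at h2
      simp only [Complex.ofReal_im, abs_zero, zero_le_one, if_true, Complex.add_re,
        Complex.ofReal_re]
      linarith }, fun x => by simp⟩

end Limit

section Distortion

lemma exists_sqrt_on_ball {v : ℂ → ℂ} {z₀ : ℂ} {R : ℝ} (hR : 0 < R)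
    (hv : DifferentiableOn ℂ v (Metric.ball z₀ R)) (hv0 : ∀ z ∈ Metric.ball z₀ R, v z ≠ 0)
    (hv1 : v z₀ = 1) :
    ∃ S : ℂ → ℂ, DifferentiableOn ℂ S (Metric.ball z₀ R) ∧ S z₀ = 1 ∧
      ∀ z ∈ Metric.ball z₀ R, S z ^ 2 = v z := by
  have hz₀ : z₀ ∈ Metric.ball z₀ R := Metric.mem_ball_self hR
  obtain ⟨L, hL0, hL⟩ := ((hv.deriv Metric.isOpen_ball).div hv hv0).isExactOn_ball.with_val_at z₀ 0
  have hderiv : ∀ z ∈ Metric.ball z₀ R, HasDerivAt (fun z => v z * Complex.exp (-L z)) 0 z := by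
    intro z hz
    have h1 := (hv.differentiableAt (Metric.isOpen_ball.mem_nhds hz)).hasDerivAt
    refine (h1.mul (hL z hz).neg.cexp).congr_deriv ?_
    have := hv0 z hz
    simp only [Pi.div_apply]
    field_simp
    ring
  have hconst : ∀ z ∈ Metric.ball z₀ R, v z * Complex.exp (-L z) = 1 := fun z hz => by
    have := (convex_ball z₀ R).is_const_of_fderivWithin_eq_zero (𝕜 := ℂ)
      (fun y hy => (hderiv y hy).differentiableAt.differentiableWithinAt) (fun y hy => ?_) hz hz₀
    · rw [this, hv1, hL0]; simp
    · rw [fderivWithin_of_isOpen Metric.isOpen_ball hy]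
      ext
      simp [(hderiv y hy).hasFDerivAt.fderiv]
  refine ⟨fun z => Complex.exp (L z / 2), fun z hz => ?_, by simp [hL0], fun z hz => ?_⟩
  · exact ((hL z hz).div_const 2).cexp.differentiableAt.differentiableWithinAt
  · rw [← Complex.exp_nat_mul]
    have h1 := hconst z hz
    rw [Complex.exp_neg, mul_inv_eq_one₀ (Complex.exp_ne_zero _)] at h1
    rw [h1]
    congr 1
    push_cast
    ring

lemma isOpenMap_of_injOn {f : ℂ → ℂ} {z₀ : ℂ} {R : ℝ} (hR : 0 < R)
    (hf : DifferentiableOn ℂ f (Metric.ball z₀ R)) (hinj : Set.InjOn f (Metric.ball z₀ R)) :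
    ∀ s ⊆ Metric.ball z₀ R, IsOpen s → IsOpen (f '' s) := by
  refine ((hf.analyticOnNhd Metric.isOpen_ball).is_constant_or_isOpen
    (convex_ball z₀ R).isPreconnected).resolve_left ?_
  rintro ⟨w, hw⟩
  have h0 : z₀ ∈ Metric.ball z₀ R := Metric.mem_ball_self hR
  have h1 : z₀ + (R / 2 : ℝ) ∈ Metric.ball z₀ R := by
    rw [Metric.mem_ball, dist_eq_norm, add_sub_cancel_left, Complex.norm_real, Real.norm_eq_abs,
      abs_of_pos (by linarith)]
    linarith
  have h2 := hinj h0 h1 ((hw _ h0).trans (hw _ h1).symm)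
  have h3 : ((R / 2 : ℝ) : ℂ) = 0 := by linear_combination -h2
  have h4 : R / 2 = 0 := by exact_mod_cast h3
  linarith

/-- The square root of a univalent function covering the unit disk around `1` avoids a
neighbourhood of `-1`. -/
lemma norm_sqrt_add_one_ge {v S : ℂ → ℂ} {z₀ : ℂ} {R : ℝ} (hR : 0 < R)
    (hv : DifferentiableOn ℂ v (Metric.ball z₀ R)) (hinj : Set.InjOn v (Metric.ball z₀ R))
    (hv1 : v z₀ = 1) (hcov : Metric.ball (1 : ℂ) 1 ⊆ v '' Metric.ball z₀ R)
    (hS : DifferentiableOn ℂ S (Metric.ball z₀ R)) (hS1 : S z₀ = 1)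
    (hSv : ∀ z ∈ Metric.ball z₀ R, S z ^ 2 = v z) {z : ℂ} (hz : z ∈ Metric.ball z₀ R) :
    1 / 3 ≤ ‖S z + 1‖ := by
  by_contra! hlt
  set D := Metric.ball z₀ R with hD
  set V : D → ℂ := fun z => v z with hV
  have hVopen : IsOpenMap V := fun s hs => by
    have : V '' s = v '' (Subtype.val '' s) := by rw [Set.image_image]
    rw [this]
    exact isOpenMap_of_injOn hR hv hinj _ (by rintro _ ⟨y, -, rfl⟩; exact y.2)
      (Metric.isOpen_ball.isOpenMap_subtype_val s hs)
  have hVinj : Function.Injective V := fun x y hxy => Subtype.ext (hinj x.2 y.2 hxy)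
  have hpre : IsPreconnected (V ⁻¹' Metric.ball (1 : ℂ) 1) :=
    (convex_ball (1 : ℂ) 1).isPreconnected.preimage_of_isOpenMap hVinj hVopen fun w hw => by
      obtain ⟨y, hy, rfl⟩ := hcov hw
      exact ⟨⟨y, hy⟩, rfl⟩
  have hne : ∀ y : D, y ∈ V ⁻¹' Metric.ball (1 : ℂ) 1 → (S y).re ≠ 0 := fun y hy h0 => by
    have h1 := hSv y y.2
    have h2 : ‖v y - 1‖ < 1 := by simpa [hV, dist_eq_norm] using hy
    have h3 := (Complex.abs_re_le_norm _).trans_lt h2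
    rw [← h1, sq] at h3
    simp only [Complex.sub_re, Complex.mul_re, Complex.one_re, h0] at h3
    have h4 := (abs_lt.1 h3).1
    nlinarith [mul_self_nonneg (S y).im]
  have hcont : ContinuousOn (fun y : D => (S y).re) (V ⁻¹' Metric.ball (1 : ℂ) 1) :=
    (Complex.continuous_re.comp hS.continuousOn.domRestrict).continuousOn
  have hz0 : (⟨z₀, Metric.mem_ball_self hR⟩ : D) ∈ V ⁻¹' Metric.ball (1 : ℂ) 1 := by
    simp [hV, hv1]
  have hb := norm_nonneg (S z + 1)
  have hzm : (⟨z, hz⟩ : D) ∈ V ⁻¹' Metric.ball (1 : ℂ) 1 := by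
    have h1 : v z - 1 = (S z + 1) * ((S z + 1) - 2) := by rw [← hSv z hz]; ring
    have h2 : ‖(S z + 1) - 2‖ ≤ ‖S z + 1‖ + 2 := by
      simpa using norm_sub_le (S z + 1) 2
    simp only [hV, Set.mem_preimage, Metric.mem_ball, dist_eq_norm, h1, norm_mul]
    nlinarith
  have hneg : (S z).re ≤ 0 := by
    have h1 := (abs_lt.1 ((Complex.abs_re_le_norm _).trans_lt hlt)).2
    simp only [Complex.add_re, Complex.one_re] at h1
    linarith
  obtain ⟨y, hy, hy0⟩ := hpre.intermediate_value hzm hz0 hcont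
    (show (0 : ℝ) ∈ Set.Icc _ _ from ⟨hneg, by simp [hS1]⟩)
  exact hne y hy hy0

/-- A Koebe-type distortion bound: a univalent function on a disk of radius `20` which omits a value
at distance at most `20` from the image of the centre is bounded on the concentric unit disk. -/
lemma norm_sub_le_of_injOn {f : ℂ → ℂ} {z₀ b : ℂ}
    (hf : DifferentiableOn ℂ f (Metric.ball z₀ 20)) (hinj : Set.InjOn f (Metric.ball z₀ 20))
    (hb : b ∉ f '' Metric.ball z₀ 20) (hb' : ‖b - f z₀‖ ≤ 20) {z : ℂ} (hz : ‖z - z₀‖ ≤ 1) :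
    ‖f z - f z₀‖ ≤ 520 := by
  have hz₀ : z₀ ∈ Metric.ball z₀ (20 : ℝ) := Metric.mem_ball_self (by norm_num)
  have hopen : IsOpen (f '' Metric.ball z₀ 20) :=
    isOpenMap_of_injOn (by norm_num) hf hinj _ subset_rfl Metric.isOpen_ball
  obtain ⟨a, ha, hda⟩ := hopen.isClosed_compl.exists_infDist_eq_dist ⟨b, hb⟩ (f z₀)
  have hane : a - f z₀ ≠ 0 := fun h => ha (sub_eq_zero.1 h ▸ Set.mem_image_of_mem f hz₀)
  have hd20 : ‖a - f z₀‖ ≤ 20 := by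
    refine le_trans ?_ hb'
    rw [← dist_eq_norm, ← dist_eq_norm, dist_comm, ← hda, dist_comm b]
    exact Metric.infDist_le_dist_of_mem hb
  set v : ℂ → ℂ := fun z => (a - f z) / (a - f z₀) with hv
  have hvd : DifferentiableOn ℂ v (Metric.ball z₀ 20) := (hf.const_sub a).div_const _
  have hv0 : ∀ z ∈ Metric.ball z₀ 20, v z ≠ 0 := fun z hz h => by
    rw [hv, div_eq_zero_iff, or_iff_left hane, sub_eq_zero] at h
    exact ha (h ▸ Set.mem_image_of_mem f hz)
  have hv1 : v z₀ = 1 := div_self hane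
  have hvinj : Set.InjOn v (Metric.ball z₀ 20) := fun x hx y hy hxy => by
    refine hinj hx hy ?_
    have := (div_left_inj' hane).1 hxy
    linear_combination -this
  have hcov : Metric.ball (1 : ℂ) 1 ⊆ v '' Metric.ball z₀ 20 := fun w hw => by
    have hw' : ‖1 - w‖ < 1 := by rwa [Metric.mem_ball, dist_comm, dist_eq_norm] at hw
    have hmem : f z₀ + (1 - w) * (a - f z₀) ∈ f '' Metric.ball z₀ 20 := by
      by_contra hnot
      have h1 := Metric.infDist_le_dist_of_mem (x := f z₀)
        (show f z₀ + (1 - w) * (a - f z₀) ∈ (f '' Metric.ball z₀ 20)ᶜ from hnot)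
      rw [hda, dist_comm, dist_comm (f z₀), dist_eq_norm, dist_eq_norm, add_sub_cancel_left,
        norm_mul] at h1
      nlinarith [norm_pos_iff.2 hane]
    obtain ⟨y, hy, hyw⟩ := hmem
    refine ⟨y, hy, ?_⟩
    simp only [hv, hyw]
    field_simp
    ring
  obtain ⟨S, hSd, hS1, hSv⟩ := exists_sqrt_on_ball (by norm_num) hvd hv0 hv1
  have hS := fun z hz => norm_sqrt_add_one_ge (by norm_num) hvd hvinj hv1 hcov hSd hS1 hSv (z := z) hz
  have hSne : ∀ z ∈ Metric.ball z₀ 20, S z + 1 ≠ 0 := fun z hz h => by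
    have := hS z hz
    rw [h, norm_zero] at this
    norm_num at this
  have hT : DifferentiableOn ℂ (fun z => (S z + 1)⁻¹) (Metric.ball z₀ 20) :=
    (hSd.add_const 1).inv hSne
  have hTmaps : Set.MapsTo (fun z => (S z + 1)⁻¹) (Metric.ball z₀ 20)
      (Metric.closedBall ((S z₀ + 1)⁻¹) 4) := fun y hy => by
    have h1 : ‖(S y + 1)⁻¹‖ ≤ 3 := by
      rw [norm_inv]
      refine inv_le_of_inv_le₀ (by norm_num) ?_
      simpa using hS y hy
    have h2 : ‖(S z₀ + 1)⁻¹‖ ≤ 1 := by rw [hS1]; norm_num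
    rw [Metric.mem_closedBall, dist_eq_norm]
    exact (norm_sub_le _ _).trans (by linarith)
  have hzD : z ∈ Metric.ball z₀ 20 := by
    rw [Metric.mem_ball, dist_eq_norm]; linarith
  have hsch := Complex.dist_le_div_mul_dist_of_mapsTo_ball hT hTmaps hzD
  rw [dist_eq_norm, dist_eq_norm, hS1, show ((1 : ℂ) + 1)⁻¹ = 1 / 2 by norm_num] at hsch
  have hTge : 3 / 10 ≤ ‖(S z + 1)⁻¹‖ := by
    have h1 := norm_sub_norm_le (1 / 2 : ℂ) ((S z + 1)⁻¹)
    rw [norm_sub_rev] at h1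
    have h2 : ‖(1 / 2 : ℂ)‖ = 1 / 2 := by norm_num
    linarith
  have hSle : ‖S z‖ ≤ 5 := by
    rw [norm_inv, le_inv_comm₀ (by norm_num) (norm_pos_iff.2 (hSne z hzD))] at hTge
    have h1 := norm_sub_le (S z + 1) 1
    rw [add_sub_cancel_right, norm_one] at h1
    norm_num at hTge
    linarith
  have hfin : f z - f z₀ = (1 - S z ^ 2) * (a - f z₀) := by
    rw [hSv z hzD, hv]
    field_simp
    ring
  rw [hfin, norm_mul]
  have h1 : ‖1 - S z ^ 2‖ ≤ 26 := by
    refine (norm_sub_le _ _).trans ?_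
    rw [norm_one, norm_pow]
    nlinarith [norm_nonneg (S z)]
  nlinarith [norm_nonneg (a - f z₀)]

end Distortion

section Fourier

variable {φ : ℂ → ℂ} {μ : ℝ}

lemma integral_line_eq (hd : DifferentiableOn ℂ φ {z : ℂ | |z.im| ≤ μ})
    (hp : ∀ z, φ (z + 1) = φ z) {y y' : ℝ} (hy : |y| ≤ μ) (hy' : |y'| ≤ μ) :
    ∫ x : ℝ in (0 : ℝ)..1, φ (x + y * Complex.I) = ∫ x : ℝ in (0 : ℝ)..1, φ (x + y' * Complex.I) := by
  have h := Complex.integral_boundary_rect_eq_zero_of_differentiableOn φ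
    (y * Complex.I) (1 + y' * Complex.I) (hd.mono fun z hz => by
      have h2 : z.im ∈ Set.uIcc y y' := by simpa using hz.2
      exact abs_le.2 (Set.uIcc_subset_Icc (abs_le.1 hy) (abs_le.1 hy') h2))
  have hper : ∀ t : ℝ, φ (1 + t * Complex.I) = φ (t * Complex.I) := fun t => by
    rw [add_comm, hp]
  simp only [Complex.mul_re, Complex.ofReal_re, Complex.I_re, mul_zero, Complex.ofReal_im,
    Complex.I_im, mul_one, sub_self, Complex.add_re, Complex.one_re, add_zero, Complex.mul_im,
    Complex.add_im, Complex.one_im, zero_add, Complex.ofReal_one, Complex.ofReal_zero, hper,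
    add_sub_cancel_right] at h
  exact sub_eq_zero.1 h

lemma differentiable_fmode (k : ℤ) : Differentiable ℂ (fmode k) := by
  unfold fmode; fun_prop

lemma fmode_neg_mul (k : ℤ) (z : ℂ) : fmode (-k) z * fmode k z = 1 := by
  rw [← fmode_add_index, neg_add_cancel, fmode_zero]

/-- The `k`-th Fourier coefficient of the restriction of `φ` to the real line. -/
noncomputable def realCoeff (φ : ℂ → ℂ) (k : ℤ) : ℂ :=
  ∫ x : ℝ in (0 : ℝ)..1, φ x * fmode (-k) x

lemma realCoeff_eq (hd : DifferentiableOn ℂ φ {z : ℂ | |z.im| ≤ μ})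
    (hp : ∀ z, φ (z + 1) = φ z) (k : ℤ) {y : ℝ} (hy : |y| ≤ μ) :
    realCoeff φ k = ∫ x : ℝ in (0 : ℝ)..1, φ (x + y * Complex.I) * fmode (-k) (x + y * Complex.I) := by
  have h := integral_line_eq (φ := fun z => φ z * fmode (-k) z)
    (hd.mul (differentiable_fmode _).differentiableOn)
    (fun z => by rw [hp, fmode_add, fmode_one, mul_one]) (y := 0) (y' := y)
    (by simpa using (abs_nonneg y).trans hy) hy
  simpa [realCoeff] using h

lemma continuous_line (hd : DifferentiableOn ℂ φ {z : ℂ | |z.im| ≤ μ}) {y : ℝ} (hy : |y| ≤ μ) :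
    Continuous fun x : ℝ => φ (x + y * Complex.I) :=
  hd.continuousOn.comp_continuous (by fun_prop) fun x => by simpa using hy

lemma integral_fmode (k : ℤ) (hk : k ≠ 0) (w : ℂ) :
    ∫ x : ℝ in (0 : ℝ)..1, fmode k (x + w) = 0 := by
  have hc : 2 * Real.pi * Complex.I * (k : ℂ) ≠ 0 := by
    simp [Real.pi_ne_zero, hk]
  have h1 := fmode_one k
  simp only [fmode_add, intervalIntegral.integral_mul_const]
  simp only [fmode, mul_one] at h1 ⊢
  rw [integral_exp_mul_complex hc]
  simp [h1]

lemma norm_realCoeff_le (hμ : 0 ≤ μ) (hd : DifferentiableOn ℂ φ {z : ℂ | |z.im| ≤ μ})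
    (hp : ∀ z, φ (z + 1) = φ z) {C : ℝ}
    (hosc : ∀ z : ℂ, |z.im| ≤ μ → ∀ x : ℝ, 0 ≤ x → x ≤ 1 → ‖φ (x + z) - φ z‖ ≤ C)
    (k : ℤ) (hk : k ≠ 0) : ‖realCoeff φ k‖ ≤ C * fweight k (-μ) := by
  obtain ⟨y, hy, hky⟩ : ∃ y : ℝ, |y| ≤ μ ∧ k * y = |(k : ℝ)| * (-μ) := by
    rcases le_total 0 (k : ℝ) with h | h
    · exact ⟨-μ, by rw [abs_neg, abs_of_nonneg hμ], by rw [abs_of_nonneg h]⟩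
    · exact ⟨μ, by rw [abs_of_nonneg hμ], by rw [abs_of_nonpos h]; ring⟩
  have him : |(y * Complex.I : ℂ).im| ≤ μ := by simpa using hy
  have hsub : realCoeff φ k = ∫ x : ℝ in (0 : ℝ)..1,
      (φ (x + y * Complex.I) - φ (y * Complex.I)) * fmode (-k) (x + y * Complex.I) := by
    have hm : Continuous fun x : ℝ => fmode (-k) (x + y * Complex.I) :=
      (differentiable_fmode _).continuous.comp (by fun_prop)
    have hi : Continuous fun x : ℝ => φ (x + y * Complex.I) * fmode (-k) (x + y * Complex.I) :=
      (continuous_line hd hy).mul hm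
    have hi' : Continuous fun x : ℝ => φ (y * Complex.I) * fmode (-k) (x + y * Complex.I) :=
      continuous_const.mul hm
    simp only [sub_mul]
    rw [intervalIntegral.integral_sub (hi.intervalIntegrable _ _) (hi'.intervalIntegrable _ _), ← realCoeff_eq hd hp k hy,
      intervalIntegral.integral_const_mul, integral_fmode _ (neg_ne_zero.2 hk), mul_zero, sub_zero]
  rw [hsub]
  refine (intervalIntegral.norm_integral_le_of_norm_le_const
    (C := C * fweight k (-μ)) fun x hx => ?_).trans (by simp)
  rw [Set.uIoc_of_le zero_le_one] at hx
  rw [norm_mul]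
  have hm : ‖fmode (-k) (x + y * Complex.I)‖ = fweight k (-μ) := by
    rw [norm_fmode, fweight]
    congr 1
    simp only [Complex.add_im, Complex.ofReal_im, Complex.mul_im, Complex.ofReal_re, Complex.I_im,
      Complex.I_re, mul_one, mul_zero, zero_add, add_zero]
    push_cast
    linear_combination 2 * Real.pi * hky
  rw [hm]
  exact mul_le_mul_of_nonneg_right (hosc _ him x hx.1.le hx.2) (fweight_pos _ _).le

lemma hasSum_realCoeff (hd : DifferentiableOn ℂ φ {z : ℂ | |z.im| ≤ μ})
    (hp : ∀ z, φ (z + 1) = φ z) {z : ℂ} (hz : |z.im| ≤ μ)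
    (hs : Summable fun k : ℤ => realCoeff φ k * fmode k z) :
    HasSum (fun k : ℤ => realCoeff φ k * fmode k z) (φ z) := by
  have : Fact (0 < (1 : ℝ)) := ⟨one_pos⟩
  have hper : Function.Periodic (fun x : ℝ => φ (x + z.im * Complex.I)) 1 := fun x => by
    simp only [Complex.ofReal_add, Complex.ofReal_one]
    rw [add_right_comm, hp]
  let u : C(AddCircle (1 : ℝ), ℂ) := ⟨hper.lift, continuous_coinduced_dom.2 (continuous_line hd hz)⟩
  have hu : ∀ x : ℝ, u x = φ (x + z.im * Complex.I) := fun x => hper.lift_coe x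
  have hmode : ∀ (k : ℤ) (x : ℝ), fourier k (x : AddCircle (1 : ℝ)) = fmode k x := fun k x => by
    rw [fourier_coe_apply, fmode]; simp
  have hcoeff : ∀ k : ℤ, fourierCoeff u k = realCoeff φ k * fmode k (z.im * Complex.I) := fun k => by
    rw [fourierCoeff_eq_intervalIntegral u k 0, realCoeff_eq hd hp k hz,
      ← intervalIntegral.integral_mul_const]
    simp only [hu, hmode, zero_add, div_one, one_smul, smul_eq_mul]
    refine intervalIntegral.integral_congr fun x _ => ?_
    have := fmode_neg_mul k (z.im * Complex.I)
    simp only [fmode_add]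
    linear_combination -φ (x + z.im * Complex.I) * fmode (-k) x * this
  have hterm : ∀ k : ℤ, fourierCoeff u k * fmode k z.re = realCoeff φ k * fmode k z := fun k => by
    rw [hcoeff, mul_assoc, ← fmode_add, add_comm (_ * Complex.I), Complex.re_add_im]
  have hsum : Summable (fourierCoeff u) := by
    refine Summable.of_norm (hs.norm.congr fun k => ?_)
    rw [← hterm, norm_mul, norm_fmode_ofReal, mul_one]
  have := has_pointwise_sum_fourier_series_of_summable hsum (z.re : AddCircle (1 : ℝ))
  simpa only [hmode, smul_eq_mul, hterm, hu, Complex.re_add_im] using this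

lemma hasSum_pow_natAbs {p : ℝ} (hp0 : 0 ≤ p) (hp1 : p < 1) :
    HasSum (fun k : ℤ => p ^ k.natAbs) ((1 - p)⁻¹ + p * (1 - p)⁻¹) := by
  have h := hasSum_geometric_of_lt_one hp0 hp1
  refine HasSum.of_nat_of_neg_add_one (by simpa using h) ?_
  have he : (fun n : ℕ => p ^ (-((n : ℤ) + 1)).natAbs) = fun n => p * p ^ n := by
    funext n
    rw [← pow_succ']
    congr 1
  rw [he]
  exact h.mul_left p

lemma fweight_neg_eq_pow (k : ℤ) (r : ℝ) :
    fweight k (-r) = Real.exp (-(2 * Real.pi * r)) ^ k.natAbs := by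
  rw [← Real.exp_nat_mul, fweight, Nat.cast_natAbs]
  push_cast
  ring_nf

lemma exp_neg_six_pi_le : Real.exp (-(2 * Real.pi * 3)) ≤ 1 / 2 ^ 18 := by
  have h2 : (2 : ℝ) ≤ Real.exp 1 := by linarith [Real.exp_one_gt_d9]
  rw [Real.exp_neg, one_div]
  refine inv_anti₀ (by positivity) ?_
  calc (2 : ℝ) ^ 18 ≤ Real.exp 1 ^ 18 := by gcongr
    _ = Real.exp 18 := by rw [← Real.exp_nat_mul]; norm_num
    _ ≤ _ := Real.exp_le_exp.2 (by linarith [Real.pi_gt_three])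

lemma exists_wienerOn (hμ : 6 ≤ μ) (hd : DifferentiableOn ℂ φ {z : ℂ | |z.im| ≤ μ})
    (hp : ∀ z, φ (z + 1) = φ z)
    (hosc : ∀ z : ℂ, |z.im| ≤ μ → ∀ x : ℝ, 0 ≤ x → x ≤ 1 → ‖φ (x + z) - φ z‖ ≤ 521) :
    ∃ (c : ℂ) (g : ℂ → ℂ), WienerOn (μ - 6) (1 / 16) g ∧
      ∀ z : ℂ, |z.im| ≤ μ - 6 → φ z = c + g z := by
  set p := Real.exp (-(2 * Real.pi * 3)) with hpdef
  have hp0 : 0 < p := Real.exp_pos _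
  have hp18 : p ≤ 1 / 2 ^ 18 := exp_neg_six_pi_le
  have hp1 : p < 1 := hp18.trans_lt (by norm_num)
  let a : ℤ → ℂ := fun k => if k = 0 then 0 else realCoeff φ k
  have hle : ∀ k : ℤ, ‖a k‖ * fweight k (μ - 6) ≤ 521 * p * p ^ k.natAbs := fun k => by
    by_cases hk : k = 0
    · simp only [a, hk, if_true, norm_zero, zero_mul]; positivity
    · have h1 := norm_realCoeff_le (by linarith) hd hp hosc k hk
      simp only [a, hk, if_false]
      calc ‖realCoeff φ k‖ * fweight k (μ - 6)
          ≤ 521 * fweight k (-μ) * fweight k (μ - 6) :=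
            mul_le_mul_of_nonneg_right h1 (fweight_pos _ _).le
        _ = 521 * (p ^ k.natAbs * p ^ k.natAbs) := by
            rw [mul_assoc, ← fweight_add, hpdef, ← fweight_neg_eq_pow, ← fweight_add]
            ring_nf
        _ ≤ 521 * (p * p ^ k.natAbs) := by
            gcongr
            exact pow_le_of_le_one hp0.le hp1.le (Int.natAbs_ne_zero.2 hk)
        _ = _ := by ring
  have hgeo := (hasSum_pow_natAbs hp0.le hp1).mul_left (521 * p)
  have hsum : Summable fun k : ℤ => ‖a k‖ * fweight k (μ - 6) :=
    Summable.of_nonneg_of_le (fun k => mul_nonneg (norm_nonneg _) (fweight_pos _ _).le) hle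
      hgeo.summable
  have hbound : 521 * p * ((1 - p)⁻¹ + p * (1 - p)⁻¹) ≤ 1 / 16 := by
    have : (1 - p)⁻¹ ≤ 2 := by
      rw [inv_le_comm₀ (by linarith) (by norm_num)]
      linarith
    have h3 : (1 - p)⁻¹ + p * (1 - p)⁻¹ ≤ 4 := by
      have : 0 < (1 - p)⁻¹ := inv_pos.2 (by linarith)
      nlinarith
    nlinarith
  have hterm : ∀ z : ℂ, |z.im| ≤ μ - 6 → Summable fun k : ℤ => a k * fmode k z := fun z hz =>
    Summable.of_norm_bounded hsum fun k => by
      rw [norm_mul]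
      exact mul_le_mul_of_nonneg_left (norm_fmode_le k hz) (norm_nonneg _)
  have hupd : ∀ z : ℂ, (fun k : ℤ => realCoeff φ k * fmode k z) =
      fun k => (if k = 0 then realCoeff φ 0 else 0) + a k * fmode k z := fun z => by
    funext k
    by_cases hk : k = 0
    · simp [a, hk, fmode_zero]
    · simp [a, hk]
  refine ⟨realCoeff φ 0, fun z => ∑' k : ℤ, a k * fmode k z,
    ⟨ℤ, a, id, ⟨_, (hasSum_le hle hsum.hasSum hgeo).trans hbound, hsum.hasSum⟩,
      fun z hz => (hterm z hz).hasSum⟩, fun z hz => ?_⟩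
  have hS := (hasSum_ite_eq (0 : ℤ) (realCoeff φ 0)).add (hterm z hz).hasSum
  rw [← hupd z] at hS
  exact (hasSum_realCoeff hd hp (by linarith) hS.summable).unique hS

end Fourier

section Conclusion

variable {ν α : ℝ}

lemma AnalyticCircleDiffeo.map_add_natCast (f : AnalyticCircleDiffeo ν) (z : ℂ) (n : ℕ) :
    f.toFun (z + n) = f.toFun z + n := by
  induction n with
  | zero => simp
  | succ n ih => rw [Nat.cast_succ, ← add_assoc, f.map_add_one, ih, add_assoc]

lemma AnalyticCircleDiffeo.norm_oscillation_le (f : AnalyticCircleDiffeo ν) {z : ℂ}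
    (hz : |z.im| ≤ ν - 20) {x : ℝ} (hx0 : 0 ≤ x) (hx1 : x ≤ 1) :
    ‖(f.toFun (x + z) - (x + z)) - (f.toFun z - z)‖ ≤ 521 := by
  have hball : Metric.ball z 20 ⊆ {w : ℂ | |w.im| ≤ ν} := fun w hw => by
    rw [Metric.mem_ball, dist_eq_norm] at hw
    have h1 := (Complex.abs_im_le_norm (w - z)).trans hw.le
    rw [Complex.sub_im] at h1
    have h2 := abs_add_le (w.im - z.im) z.im
    rw [sub_add_cancel] at h2
    simp only [Set.mem_ofPred_eq]
    linarith
  have hmap := f.map_add_natCast z 20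
  have hb : f.toFun z + 20 ∉ f.toFun '' Metric.ball z 20 := by
    rintro ⟨w, hw, hfw⟩
    have : w = z + (20 : ℕ) := f.injOn (hball hw)
      (by simp only [Set.mem_ofPred_eq, Complex.add_im, Complex.natCast_im, add_zero]; linarith)
      (by rw [hmap, hfw]; norm_num)
    rw [this, Metric.mem_ball, dist_eq_norm] at hw
    norm_num at hw
  have hnx : ‖(x : ℂ)‖ ≤ 1 := by
    rwa [Complex.norm_real, Real.norm_eq_abs, abs_of_nonneg hx0]
  have h := norm_sub_le_of_injOn (f.diffOn.mono hball) (f.injOn.mono hball) hb (by simp)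
    (z := x + z) (by simpa using hnx)
  calc ‖(f.toFun (x + z) - (x + z)) - (f.toFun z - z)‖
      = ‖(f.toFun (x + z) - f.toFun z) - x‖ := by congr 1; ring
    _ ≤ ‖f.toFun (x + z) - f.toFun z‖ + ‖(x : ℂ)‖ := norm_sub_le _ _
    _ ≤ 521 := by linarith

lemma AnalyticCircleDiffeo.ofReal_re_toFun (f : AnalyticCircleDiffeo ν) (x : ℝ) :
    ((f.toFun x).re : ℂ) = f.toFun x :=
  Complex.ext (by simp) (by simp [f.real_toFun])

lemma AnalyticCircleDiffeo.almostConj (f : AnalyticCircleDiffeo ν) (hν : 26 ≤ ν)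
    (hrot : IsRotNumber (fun x : ℝ => (f.toFun x).re) α) :
    AlmostConj (fun x : ℝ => (f.toFun x).re) α (fun _ => 0) (ν - 26) (1 / 16) := by
  obtain ⟨c, g, hg, hφ⟩ := exists_wienerOn (φ := fun z => f.toFun z - z) (μ := ν - 20)
    (by linarith)
    ((f.diffOn.mono fun z (hz : |z.im| ≤ ν - 20) => (by linarith : |z.im| ≤ ν)).sub
      differentiableOn_id)
    (fun z => by rw [f.map_add_one]; ring)
    (fun z hz x hx0 hx1 => f.norm_oscillation_le hz hx0 hx1)
  rw [show ν - 20 - 6 = ν - 26 by ring] at hg hφ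
  have hr : 0 ≤ ν - 26 := by linarith
  obtain ⟨g', hg', hgg'⟩ := hg.symmetrize hr
  have hconj : ∀ x : ℝ, (((f.toFun x).re : ℝ) : ℂ) + 0 =
      x + 0 + (α + ((c.re - α : ℝ) : ℂ) + g' (x + 0)) := fun x => by
    have h := congrArg Complex.re (hφ x (by simpa using hr))
    simp only [Complex.sub_re, Complex.ofReal_re, Complex.add_re] at h
    rw [add_zero, add_zero, hgg']
    norm_cast
    linarith
  have hre : ∀ x : ℝ, (g' x).im = 0 := fun x => by rw [hgg']; simp
  exact ⟨c.re - α, g', hg', hre,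
    abs_le_of_conj hrot (by simpa using WienerOn.const 0 2) (by simp) hr hg' hconj, hconj⟩

end Conclusion

/-- **Yoccoz.** There exists `ν₀ > 0` such that any analytic circle diffeomorphism with
Brjuno rotation number `α` which is analytic and injective on the strip `T_ν` with
`ν ≥ (1/2π) B(α) + ν₀` is analytically linearizable. -/
theorem yoccoz_linearization_wide_strip :
    ∃ ν₀ > (0 : ℝ), ∀ α : ℝ, Irrational α → IsBrjuno α →
      ∀ ν : ℝ, (brjunoFunction α).toReal / (2 * Real.pi) + ν₀ ≤ ν →
      ∀ f : AnalyticCircleDiffeo ν,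
        IsRotNumber (fun x : ℝ => (f.toFun x).re) α →
        ∃ ν' > (0 : ℝ), ∃ h : AnalyticCircleDiffeo ν',
          ∀ x : ℝ, h.toFun (f.toFun x) = h.toFun x + α := by
  have hT : 0 ≤ ∑' n, brjunoMajorant n := tsum_nonneg brjunoMajorant_nonneg
  have hc : 0 ≤ 5 * (∑' n, brjunoMajorant n) / (2 * Real.pi) := by positivity
  refine ⟨59 + 5 * (∑' n, brjunoMajorant n) / (2 * Real.pi), by linarith,
    fun α hα hB ν hν f hrot => ?_⟩
  have hB0 : 0 ≤ (brjunoFunction α).toReal / (2 * Real.pi) := by positivity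
  obtain ⟨Ψ, hΨ, hΨr, hconj⟩ := exists_linearization hα hrot
    (f.almostConj (by linarith) hrot) fun m => by
      have h1 := div_le_div_of_nonneg_right (sum_log_qden_div_le hα hB m) Real.two_pi_pos.le
      rw [add_div] at h1
      have h2 : (0 : ℝ) ≤ (1 / 2) ^ m := by positivity
      rw [stageWidth]
      linarith
  obtain ⟨h, hh⟩ := hΨ.exists_diffeo hΨr
  refine ⟨1, one_pos, h, fun x => ?_⟩
  rw [← f.ofReal_re_toFun x, hh, hh, hconj]
end
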